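/- Let s ≥ 6 be an integer and let μ₁, …, μ_s be real numbers with μ₁ irrational. Then the set F(ℤ^s) = { F(x₁, …, x_s) : x₁, …, x_s ∈ ℤ } is dense in ℝ. -/

import Mathlib

section

open Filter Topology

theorem exists_int_pair_sq_le (β : ℝ) {R : ℝ} (hR : 0 < R) :
    ∃ x y : ℤ, (x ≠ 0 ∨ y ≠ 0) ∧ ((x : ℝ) + β * y) ^ 2 ≤ R ∧ R * (y : ℝ) ^ 2 ≤ 1 := by
  rcases le_or_gt 1 R with h1 | h1
  · exact ⟨1, 0, Or.inl one_ne_zero, by simpa using h1, by simp⟩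
  set T := √(1 / R) with hT
  have hT2 : T ^ 2 = 1 / R := Real.sq_sqrt (by positivity)
  have hT0 : 0 ≤ T := Real.sqrt_nonneg _
  have hT1 : 1 ≤ T := by
    rw [hT, Real.one_le_sqrt, le_div_iff₀ hR]; linarith
  have hN : 0 < ⌊T⌋₊ := Nat.floor_pos.2 hT1
  obtain ⟨j, k, hk0, hk, hjk⟩ := Real.exists_int_int_abs_mul_sub_le β hN
  have hkT : (k : ℝ) ≤ T := by
    have : (k : ℝ) ≤ (⌊T⌋₊ : ℝ) := by exact_mod_cast hk
    exact this.trans (Nat.floor_le hT0)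
  have hk0' : (0 : ℝ) < k := by exact_mod_cast hk0
  have hlt : T < ⌊T⌋₊ + 1 := Nat.lt_floor_add_one T
  refine ⟨-j, k, Or.inr hk0.ne', ?_, ?_⟩
  · have h2 : |(k : ℝ) * β - j| ≤ 1 / T :=
      hjk.trans (one_div_le_one_div_of_le (by linarith) hlt.le)
    have h3 : ((k : ℝ) * β - j) ^ 2 ≤ (1 / T) ^ 2 := by
      rw [← sq_abs]; gcongr
    calc (((-j : ℤ) : ℝ) + β * k) ^ 2 = ((k : ℝ) * β - j) ^ 2 := by push_cast; ring
      _ ≤ (1 / T) ^ 2 := h3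
      _ = R := by rw [div_pow, hT2]; field_simp
  · calc R * (k : ℝ) ^ 2 ≤ R * T ^ 2 := by gcongr
      _ = 1 := by rw [hT2]; field_simp

/-- Every real interval of length one, open on the left, contains a translate of an integer. -/
theorem exists_int_add_mem_Ico (c r : ℝ) : ∃ k : ℤ, r ≤ k + c ∧ k + c < r + 1 :=
  ⟨⌈r - c⌉, by linarith [Int.le_ceil (r - c)], by linarith [Int.ceil_lt_add_one (r - c)]⟩

theorem exists_isCoprime_abs_binary_le (a b c : ℝ) (hD : 0 < b ^ 2 - a * c) :
    ∃ p q : ℤ, IsCoprime p q ∧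
      |a * (p : ℝ) ^ 2 + 2 * b * p * q + c * (q : ℝ) ^ 2| ≤ √(b ^ 2 - a * c) := by
  set D := b ^ 2 - a * c with hDdef
  rcases eq_or_ne a 0 with rfl | ha
  · exact ⟨1, 0, isCoprime_one_left, by simp⟩
  have hS : 0 < √D := Real.sqrt_pos.2 hD
  have hSS : √D * √D = D := Real.mul_self_sqrt hD.le
  have haa : 0 < |a| := abs_pos.2 ha
  obtain ⟨x, y, hxy, h1, h2⟩ := exists_int_pair_sq_le (b / a) (div_pos hS haa)
  have key : |a * (x : ℝ) ^ 2 + 2 * b * x * y + c * (y : ℝ) ^ 2| ≤ √D := by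
    have e1 : |a| * ((x : ℝ) + b / a * y) ^ 2 ≤ √D := by
      rw [le_div_iff₀ haa] at h1; linarith
    have e2 : D / |a| * (y : ℝ) ^ 2 ≤ √D := by
      calc D / |a| * (y : ℝ) ^ 2 = √D * (√D / |a| * (y : ℝ) ^ 2) := by
            rw [← mul_assoc, mul_div_assoc', hSS]
        _ ≤ √D * 1 := by gcongr
        _ = √D := mul_one _
    have e3 : 0 ≤ |a| * ((x : ℝ) + b / a * y) ^ 2 := by positivity
    have e4 : 0 ≤ D / |a| * (y : ℝ) ^ 2 := by positivity
    have e5 : a * (x : ℝ) ^ 2 + 2 * b * x * y + c * (y : ℝ) ^ 2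
        = a * ((x : ℝ) + b / a * y) ^ 2 - D / a * (y : ℝ) ^ 2 := by
      rw [hDdef]; field_simp; ring
    rw [e5, abs_le]
    rcases abs_cases a with ⟨h, -⟩ | ⟨h, -⟩ <;> rw [h] at e1 e2 e3 e4
    · constructor <;> linarith
    · rw [div_neg] at e2 e4
      constructor <;> linarith
  have hg : Int.gcd x y ≠ 0 := by
    rw [Ne, Int.gcd_eq_zero_iff]; tauto
  obtain ⟨p, q, hpq, hx, hy⟩ := Int.exists_gcd_one (Nat.pos_of_ne_zero hg)
  refine ⟨p, q, Int.isCoprime_iff_gcd_eq_one.2 hpq, le_trans ?_ key⟩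
  set g : ℝ := (Int.gcd x y : ℝ) with hgdef
  have hg1 : 1 ≤ g := by
    rw [hgdef]; exact_mod_cast Nat.one_le_iff_ne_zero.2 hg
  have hx' : (x : ℝ) = p * g := by rw [hgdef]; exact_mod_cast hx
  have hy' : (y : ℝ) = q * g := by rw [hgdef]; exact_mod_cast hy
  rw [hx', hy', show a * ((p : ℝ) * g) ^ 2 + 2 * b * (p * g) * (q * g) + c * (q * g) ^ 2
    = g ^ 2 * (a * (p : ℝ) ^ 2 + 2 * b * p * q + c * (q : ℝ) ^ 2) by ring, abs_mul,
    abs_of_nonneg (by positivity : 0 ≤ g ^ 2)]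
  exact le_mul_of_one_le_left (abs_nonneg _) (one_le_pow₀ hg1)

theorem exists_isCoprime_binary_pos_le (a b c : ℝ) (hD : 0 < b ^ 2 - a * c) :
    ∃ p q : ℤ, IsCoprime p q ∧ 0 < a * (p : ℝ) ^ 2 + 2 * b * p * q + c * (q : ℝ) ^ 2 ∧
      a * (p : ℝ) ^ 2 + 2 * b * p * q + c * (q : ℝ) ^ 2 ≤ 2 * √(b ^ 2 - a * c) := by
  obtain ⟨p, q, ⟨u, v, huv⟩, hle⟩ := exists_isCoprime_abs_binary_le a b c hD
  set D := b ^ 2 - a * c with hDdef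
  have hS : 0 < √D := Real.sqrt_pos.2 hD
  have hSS : √D ^ 2 = D := Real.sq_sqrt hD.le
  have huv' : (u : ℝ) * p + v * q = 1 := by exact_mod_cast huv
  set A := a * (p : ℝ) ^ 2 + 2 * b * p * q + c * (q : ℝ) ^ 2 with hA
  rcases lt_or_ge 0 A with h0 | h0
  · exact ⟨p, q, ⟨u, v, huv⟩, h0, by linarith [le_abs_self A]⟩
  set B := a * p * (-v) + b * (p * u + q * (-v)) + c * q * (u : ℝ) with hB
  set C := a * (v : ℝ) ^ 2 - 2 * b * v * u + c * (u : ℝ) ^ 2 with hC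
  have hDet : B ^ 2 - A * C = D := by
    have : B ^ 2 - A * C = D * ((u : ℝ) * p + v * q) ^ 2 := by
      rw [hA, hB, hC, hDdef]; ring
    rw [this, huv']; ring
  have hcop (y : ℤ) : IsCoprime (y * p - v) (y * q + u) :=
    ⟨-q, p, by linear_combination huv⟩
  have hval (y : ℤ) : a * ((y * p - v : ℤ) : ℝ) ^ 2
      + 2 * b * ((y * p - v : ℤ) : ℝ) * ((y * q + u : ℤ) : ℝ) + c * ((y * q + u : ℤ) : ℝ) ^ 2
      = A * (y : ℝ) ^ 2 + 2 * B * y + C := by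
    rw [hA, hB, hC]; push_cast; ring
  suffices ∃ y : ℤ, 0 < A * (y : ℝ) ^ 2 + 2 * B * y + C ∧
      A * (y : ℝ) ^ 2 + 2 * B * y + C ≤ 2 * √D by
    obtain ⟨y, h⟩ := this
    exact ⟨_, _, hcop y, by rwa [hval]⟩
  rcases h0.lt_or_eq with hneg | hzero
  · set ρ := √D / (-A) with hρ
    have hAp : 0 < -A := by linarith
    have hρ1 : 1 ≤ ρ := by
      rw [hρ, le_div_iff₀ hAp]; linarith [neg_le_abs A]
    obtain ⟨k, hk1, hk2⟩ := exists_int_add_mem_Ico (B / A) (ρ - 1)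
    set r := (k : ℝ) + B / A with hr
    have hAρ : -A * ρ = √D := mul_div_cancel₀ _ hAp.ne'
    have e : A * (k : ℝ) ^ 2 + 2 * B * k + C = -A * ((ρ - r) * (ρ + r)) := by
      have h1 : -A * (ρ - r) * (ρ + r) = (-A * ρ) * ρ + A * r ^ 2 := by ring
      have h2 : √D * ρ = D / (-A) := by rw [hρ, mul_div_assoc', ← sq, hSS]
      rw [← mul_assoc, h1, hAρ, h2, ← hDet, hr]
      have := hneg.ne
      field_simp; ring
    refine ⟨k, ?_, ?_⟩ <;> rw [e]
    · have : 0 < (ρ - r) * (ρ + r) := mul_pos (by linarith) (by linarith)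
      exact mul_pos hAp this
    · have : (ρ - r) * (ρ + r) ≤ 1 * (2 * ρ) := by
        apply mul_le_mul <;> linarith
      calc -A * ((ρ - r) * (ρ + r)) ≤ -A * (1 * (2 * ρ)) := by gcongr
        _ = 2 * (-A * ρ) := by ring
        _ = 2 * √D := by rw [hAρ]
  · rw [hzero] at hDet ⊢
    have hB2 : B ^ 2 = √D ^ 2 := by rw [hSS]; linarith
    obtain ⟨k, hk1, hk2⟩ := exists_int_add_mem_Ico (-(C / (2 * √D))) (-1)
    rcases sq_eq_sq_iff_eq_or_eq_neg.1 hB2 with h | h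
    · refine ⟨-k, ?_⟩
      have e : (0 : ℝ) * ((-k : ℤ) : ℝ) ^ 2 + 2 * B * ((-k : ℤ) : ℝ) + C
          = 2 * √D * (-(k + -(C / (2 * √D)))) := by
        rw [h]; push_cast; field_simp; ring
      rw [e]
      exact ⟨mul_pos (by positivity) (by linarith), by nlinarith⟩
    · refine ⟨k, ?_⟩
      have e : (0 : ℝ) * (k : ℝ) ^ 2 + 2 * B * (k : ℝ) + C
          = 2 * √D * (-(k + -(C / (2 * √D)))) := by
        rw [h]; field_simp; ring
      rw [e]
      exact ⟨mul_pos (by positivity) (by linarith), by nlinarith⟩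

theorem exists_sq_sub_near {f κ A g : ℝ} (hf : 0 < f) (hκ : 0 < κ) (hA0 : 0 < A) (hg0 : 0 ≤ g)
    (hgA : A * g ≤ κ / (4 * f)) (hfA : f * A ≤ 2 * √(κ * f)) (c τ : ℝ) :
    ∃ j : ℤ, 0 ≤ A * (j + c) ^ 2 - g - τ ∧ f * (A * (j + c) ^ 2 - g - τ) ≤
      2 * √(2 * √(κ * f) * f * |τ| + κ * f / 4) + 2 * √(κ * f) + f * |τ| := by
  set ρ₀ := √(max 0 ((τ + g) / A)) with hρ₀
  have hρ₀0 : 0 ≤ ρ₀ := Real.sqrt_nonneg _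
  have hρ₀2 : ρ₀ ^ 2 = max 0 ((τ + g) / A) := Real.sq_sqrt (le_max_left _ _)
  obtain ⟨j, hj1, hj2⟩ := exists_int_add_mem_Ico c ρ₀
  refine ⟨j, ?_⟩
  set r := (j : ℝ) + c with hr
  have hAA : A * ((τ + g) / A) = τ + g := by field_simp
  set w := A * r ^ 2 - g with hw
  have hwτ : 0 ≤ w - τ := by
    have h1 : ρ₀ ^ 2 ≤ r ^ 2 := by gcongr
    have h2 : (τ + g) / A ≤ r ^ 2 := by
      rw [hρ₀2] at h1; exact (le_max_right _ _).trans h1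
    have := mul_le_mul_of_nonneg_left h2 hA0.le
    rw [hAA] at this; rw [hw]; linarith
  refine ⟨hwτ, ?_⟩
  have hr2 : r ^ 2 ≤ ρ₀ ^ 2 + (2 * ρ₀ + 1) := by
    have : r ^ 2 ≤ (ρ₀ + 1) ^ 2 := pow_le_pow_left₀ (by linarith) (by linarith) 2
    linarith
  have hAρ : f * A * ρ₀ ≤ √(2 * √(κ * f) * f * |τ| + κ * f / 4) := by
    apply Real.le_sqrt_of_sq_le
    rw [mul_pow, hρ₀2]
    rcases max_cases 0 ((τ + g) / A) with ⟨h, -⟩ | ⟨h, -⟩ <;> rw [h]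
    · rw [mul_zero]; positivity
    · have e : (f * A) ^ 2 * ((τ + g) / A) = f * A * f * τ + f ^ 2 * (A * g) := by
        field_simp
      rw [e]
      have e1 : f * A * f * τ ≤ 2 * √(κ * f) * f * |τ| := by
        calc f * A * f * τ ≤ f * A * f * |τ| := by gcongr; exact le_abs_self τ
          _ ≤ _ := by gcongr
      have e2 : f ^ 2 * (A * g) ≤ κ * f / 4 := by
        calc f ^ 2 * (A * g) ≤ f ^ 2 * (κ / (4 * f)) := by gcongr
          _ = κ * f / 4 := by field_simp
      linarith
  have hmax : A * ρ₀ ^ 2 - g - τ ≤ |τ| := by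
    rw [hρ₀2]
    rcases max_cases 0 ((τ + g) / A) with ⟨h, -⟩ | ⟨h, -⟩ <;> rw [h]
    · linarith [neg_le_abs τ]
    · rw [hAA]; linarith [abs_nonneg τ]
  have : w - τ ≤ |τ| + A * (2 * ρ₀ + 1) := by
    have := mul_le_mul_of_nonneg_left hr2 hA0.le
    rw [hw]; linarith
  have := mul_le_mul_of_nonneg_left this hf.le
  linarith

theorem exists_triangular_form_near {f κ α β b h c : ℝ} (hf : 0 < f) (hκ : 0 < κ)
    (hdet : h ^ 2 - b * c = κ / f) (s₀ s₁ s₂ τ : ℝ) :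
    ∃ x y z : ℤ,
      -f * ((x + s₀) + α * (y + s₁) + β * (z + s₂)) ^ 2
        + (b * (y + s₁) ^ 2 + 2 * h * (y + s₁) * (z + s₂) + c * (z + s₂) ^ 2) ≤ τ ∧
      τ - (2 * √(2 * √(2 * √(κ * f) * f * |τ| + κ * f / 4) + 2 * √(κ * f) + f * |τ|) + f) ≤
        -f * ((x + s₀) + α * (y + s₁) + β * (z + s₂)) ^ 2
        + (b * (y + s₁) ^ 2 + 2 * h * (y + s₁) * (z + s₂) + c * (z + s₂) ^ 2) := by
  have hκf : 0 < κ / f := div_pos hκ hf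
  obtain ⟨p, q, ⟨u, v, huv⟩, hA0, hA⟩ :=
    exists_isCoprime_binary_pos_le b h c (hdet ▸ hκf)
  rw [hdet] at hA
  have huv' : (u : ℝ) * p + v * q = 1 := by exact_mod_cast huv
  set A := b * (p : ℝ) ^ 2 + 2 * h * p * q + c * (q : ℝ) ^ 2 with hAdef
  set B := b * p * (-v) + h * (p * u + q * (-v)) + c * q * (u : ℝ) with hB
  set C := b * (v : ℝ) ^ 2 - 2 * h * v * u + c * (u : ℝ) ^ 2 with hC
  have hDet : B ^ 2 - A * C = κ / f := by
    have : B ^ 2 - A * C = (h ^ 2 - b * c) * ((u : ℝ) * p + v * q) ^ 2 := by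
      rw [hAdef, hB, hC]; ring
    rw [this, huv', hdet]; ring
  -- shifts in the new basis
  set j₀ := u * s₁ + v * s₂ with hj₀
  set i₀ := p * s₂ - q * s₁ with hi₀
  obtain ⟨i, hi1, hi2⟩ := exists_int_add_mem_Ico i₀ (-1 / 2)
  set I := (i : ℝ) + i₀ with hI
  have hI2 : I ^ 2 ≤ 1 / 4 := by nlinarith
  set g := κ / (f * A) * I ^ 2 with hg
  have hg0 : 0 ≤ g := by positivity
  have hgA : A * g ≤ κ / (4 * f) := by
    have : A * g = κ / f * I ^ 2 := by rw [hg]; field_simp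
    rw [this]
    calc κ / f * I ^ 2 ≤ κ / f * (1 / 4) := by gcongr
      _ = κ / (4 * f) := by field_simp
  have hfA : f * A ≤ 2 * √(κ * f) := by
    have e : √(κ * f) = f * √(κ / f) := by
      rw [show κ * f = f ^ 2 * (κ / f) by field_simp, Real.sqrt_mul (by positivity),
        Real.sqrt_sq hf.le]
    rw [e]; nlinarith
  set W := 2 * √(2 * √(κ * f) * f * |τ| + κ * f / 4) + 2 * √(κ * f) + f * |τ| with hW
  obtain ⟨j, hwτ, hfw⟩ := exists_sq_sub_near hf hκ hA0 hg0 hgA hfA (j₀ + B / A * I) τ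
  rw [← hW] at hfw
  set r := (j : ℝ) + (j₀ + B / A * I) with hr
  set w := A * r ^ 2 - g with hw
  set x₀ := √((w - τ) / f) with hx₀
  have hx₀0 : 0 ≤ x₀ := Real.sqrt_nonneg _
  have hx₀2 : f * x₀ ^ 2 = w - τ := by
    rw [Real.sq_sqrt (by positivity)]; field_simp
  have hfx : f * x₀ ≤ √W := by
    apply Real.le_sqrt_of_sq_le
    rw [mul_pow, sq f, mul_assoc, hx₀2]; exact hfw
  set y : ℤ := j * p - i * v with hy
  set z : ℤ := j * q + i * u with hz
  obtain ⟨x, hx1, hx2⟩ := exists_int_add_mem_Ico (s₀ + α * (y + s₁) + β * (z + s₂)) x₀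
  set X := (x : ℝ) + (s₀ + α * (y + s₁) + β * (z + s₂)) with hX
  refine ⟨x, y, z, ?_⟩
  have e1 : (x : ℝ) + s₀ + α * (y + s₁) + β * (z + s₂) = X := by rw [hX]; ring
  have ey : (y : ℝ) + s₁ = (j + j₀) * p - I * v := by
    rw [hy, hI, hj₀, hi₀]; push_cast; linear_combination (-s₁) * huv'
  have ez : (z : ℝ) + s₂ = (j + j₀) * q + I * u := by
    rw [hz, hI, hj₀, hi₀]; push_cast; linear_combination (-s₂) * huv'
  have e2 : b * ((y : ℝ) + s₁) ^ 2 + 2 * h * (y + s₁) * (z + s₂) + c * (z + s₂) ^ 2 = w := by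
    have h1 : w = A * (j + j₀) ^ 2 + 2 * B * (j + j₀) * I + C * I ^ 2 := by
      have hh : g = (B ^ 2 - A * C) / A * I ^ 2 := by
        rw [hg, hDet]; field_simp
      rw [hw, hh, hr]; field_simp; ring
    rw [h1, ey, ez, hAdef, hB, hC]; ring
  rw [e1, e2]
  have hX2 : X ^ 2 ≤ (x₀ + 1) ^ 2 := by gcongr; linarith
  have hX1 : x₀ ^ 2 ≤ X ^ 2 := by gcongr
  have hX1' := mul_le_mul_of_nonneg_left hX1 hf.le
  have hX2' := mul_le_mul_of_nonneg_left hX2 hf.le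
  clear_value X w W x₀
  constructor <;> linarith

theorem exists_triangular_form_neg {D κ α β A B C : ℝ} (hD : 0 < D) (hκ : 0 < κ) (hA : 0 < A)
    (hdet : A * C - B ^ 2 = κ / D) :
    ∃ x y z : ℤ,
      D * (x + α * y + β * z) ^ 2 - (A * (y : ℝ) ^ 2 + 2 * B * y * z + C * (z : ℝ) ^ 2) < 0 ∧
      -(D + 2 * √(2 * √(κ * D))) ≤
      D * (x + α * y + β * z) ^ 2 - (A * (y : ℝ) ^ 2 + 2 * B * y * z + C * (z : ℝ) ^ 2) := by
  have hκD : 0 < κ / D := div_pos hκ hD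
  set Δ := κ / D with hΔ
  have hS : 0 < √Δ := Real.sqrt_pos.2 hκD
  have hSS : √Δ * √Δ = Δ := Real.mul_self_sqrt hκD.le
  obtain ⟨y, z, hyz, h1, h2⟩ := exists_int_pair_sq_le (B / A) (div_pos hS hA)
  set F := A * (y : ℝ) ^ 2 + 2 * B * y * z + C * (z : ℝ) ^ 2 with hF
  have eF : F = A * ((y : ℝ) + B / A * z) ^ 2 + Δ / A * (z : ℝ) ^ 2 := by
    rw [hF, ← hdet]; field_simp; ring
  have e1 : A * ((y : ℝ) + B / A * z) ^ 2 ≤ √Δ := by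
    rw [le_div_iff₀ hA] at h1; linarith
  have e2 : Δ / A * (z : ℝ) ^ 2 ≤ √Δ := by
    calc Δ / A * (z : ℝ) ^ 2 = √Δ * (√Δ / A * (z : ℝ) ^ 2) := by
          rw [← mul_assoc, mul_div_assoc', hSS]
      _ ≤ √Δ * 1 := by gcongr
      _ = √Δ := mul_one _
  have hFle : F ≤ 2 * √Δ := by linarith
  have hFpos : 0 < F := by
    rw [eF]
    rcases eq_or_ne z 0 with rfl | hz
    · have hy : (y : ℝ) ≠ 0 := by
        rcases hyz with h | h
        · exact_mod_cast h
        · exact absurd rfl h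
      simp only [Int.cast_zero, mul_zero, add_zero]; positivity
    · have hz' : (z : ℝ) ≠ 0 := by exact_mod_cast hz
      positivity
  set σ := √(F / D) with hσ
  have hσ0 : 0 < σ := Real.sqrt_pos.2 (by positivity)
  have hσ2 : D * σ ^ 2 = F := by rw [Real.sq_sqrt (by positivity)]; field_simp
  have hDσ : D * σ ≤ √(2 * √(κ * D)) := by
    apply Real.le_sqrt_of_sq_le
    have e : √(κ * D) = D * √Δ := by
      rw [show κ * D = D ^ 2 * Δ by rw [hΔ]; field_simp, Real.sqrt_mul (by positivity),
        Real.sqrt_sq hD.le]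
    rw [mul_pow, sq D, mul_assoc, hσ2, e]; nlinarith
  set k : ℕ := ⌊1 / (2 * σ)⌋₊ + 1 with hk
  have hk1 : 1 / (2 * σ) < k := by rw [hk]; push_cast; exact Nat.lt_floor_add_one _
  have hk2 : (k : ℝ) ≤ 1 / (2 * σ) + 1 := by
    rw [hk]; push_cast; linarith [Nat.floor_le (by positivity : 0 ≤ 1 / (2 * σ))]
  set ρ := k * σ with hρ
  have hσσ : 1 / (2 * σ) * σ = 1 / 2 := by field_simp
  have hρ1 : 1 / 2 < ρ := by rw [← hσσ]; exact mul_lt_mul_of_pos_right hk1 hσ0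
  have hρ2 : ρ ≤ 1 / 2 + σ := by
    have := mul_le_mul_of_nonneg_right hk2 hσ0.le
    rw [add_mul, hσσ, one_mul] at this; exact this
  obtain ⟨x, hx1, hx2⟩ := exists_int_add_mem_Ico (k * (α * y + β * z)) (ρ - 1)
  set r := (x : ℝ) + k * (α * y + β * z) with hr
  refine ⟨x, k * y, k * z, ?_⟩
  have e : D * (x + α * ((k * y : ℤ) : ℝ) + β * ((k * z : ℤ) : ℝ)) ^ 2
      - (A * ((k * y : ℤ) : ℝ) ^ 2 + 2 * B * ((k * y : ℤ) : ℝ) * ((k * z : ℤ) : ℝ)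
        + C * ((k * z : ℤ) : ℝ) ^ 2) = -(D * ((ρ - r) * (ρ + r))) := by
    have h3 : D * ((ρ - r) * (ρ + r)) = k ^ 2 * (D * σ ^ 2) - D * r ^ 2 := by rw [hρ]; ring
    rw [h3, hσ2, hF, hr]; push_cast; ring
  rw [e]
  have h4 : 0 < (ρ - r) * (ρ + r) := mul_pos (by linarith) (by linarith)
  have h5 : (ρ - r) * (ρ + r) ≤ 1 * (2 * (1 / 2 + σ)) := by
    apply mul_le_mul <;> linarith
  constructor
  · have := mul_pos hD h4; linarith
  · have h6 : D * ((ρ - r) * (ρ + r)) ≤ D * (1 * (2 * (1 / 2 + σ))) := by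
      gcongr
    linarith

theorem exists_mul_isCoprime (x y : ℤ) :
    ∃ h p q u v : ℤ, x = h * p ∧ y = h * q ∧ u * p + v * q = 1 := by
  by_cases hg : Int.gcd x y = 0
  · rw [Int.gcd_eq_zero_iff] at hg
    exact ⟨0, 1, 0, 1, 0, by simp [hg.1], by simp [hg.2], by norm_num⟩
  · obtain ⟨p, q, hpq, hx, hy⟩ := Int.exists_gcd_one (Nat.pos_of_ne_zero hg)
    obtain ⟨u, v, huv⟩ := Int.isCoprime_iff_gcd_eq_one.2 hpq
    exact ⟨Int.gcd x y, p, q, u, v, by linarith, by linarith, huv⟩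

/-- Every integer vector is a multiple of the first column of a unimodular matrix. -/
theorem exists_det_one_first_column (n : Fin 3 → ℤ) :
    ∃ (γ : Matrix (Fin 3) (Fin 3) ℤ) (h : ℤ), γ.det = 1 ∧ ∀ i, n i = h * γ i 0 := by
  obtain ⟨g, p, q, a, b, hp, hq, hab⟩ := exists_mul_isCoprime (n 0) (n 1)
  obtain ⟨h, g', r, c, d, hg, hr, hcd⟩ := exists_mul_isCoprime g (n 2)
  refine ⟨!![g' * p, -b, -d * p; g' * q, a, -d * q; r, 0, c], h, ?_, ?_⟩
  · rw [Matrix.det_fin_three]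
    simp only [Matrix.of_apply, Matrix.cons_val', Matrix.cons_val_zero, Matrix.cons_val_one,
      Matrix.cons_val, Matrix.cons_val_fin_one]
    linear_combination (c * g' + d * r) * hab + hcd
  · intro i
    fin_cases i
    · simp [hp, hg, mul_assoc]
    · simp [hq, hg, mul_assoc]
    · simp [hr]

theorem exists_real_preimage {γ : Matrix (Fin 3) (Fin 3) ℤ} (hγ : γ.det = 1) (s : Fin 3 → ℝ) :
    ∃ x y z : ℝ, ∀ i, s i = γ i 0 * x + γ i 1 * y + γ i 2 * z := by
  set M : Matrix (Fin 3) (Fin 3) ℝ := γ.map (Int.cast : ℤ → ℝ) with hM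
  have hdet : M.det = 1 := by
    have := (Int.castRingHom ℝ).map_det γ
    rw [hγ, map_one] at this
    exact this.symm
  refine ⟨(M.adjugate.mulVec s) 0, (M.adjugate.mulVec s) 1, (M.adjugate.mulVec s) 2,
    fun i => ?_⟩
  have h : M.mulVec (M.adjugate.mulVec s) = s := by
    rw [Matrix.mulVec_mulVec, Matrix.mul_adjugate, hdet, one_smul, Matrix.one_mulVec]
  have h2 := congrFun h i
  rw [Matrix.mulVec, dotProduct, Fin.sum_univ_three] at h2
  simpa [hM] using h2.symm

theorem exists_complete_square (d : Fin 3 → ℝ) {γ : Matrix (Fin 3) (Fin 3) ℤ} (hγ : γ.det = 1)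
    {a : ℝ} (ha : a ≠ 0) (hda : ∑ i, d i * (γ i 0 : ℝ) ^ 2 = a) :
    ∃ α β A B C : ℝ, A * C - B ^ 2 = d 0 * d 1 * d 2 / a ∧ ∀ x y z : ℝ,
      ∑ i, d i * (γ i 0 * x + γ i 1 * y + γ i 2 * z) ^ 2
        = a * (x + α * y + β * z) ^ 2 + (A * y ^ 2 + 2 * B * y * z + C * z ^ 2) := by
  set M : Matrix (Fin 3) (Fin 3) ℝ := γ.map (Int.cast : ℤ → ℝ) with hM
  have hdet : M.det = 1 := by
    have := (Int.castRingHom ℝ).map_det γ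
    rw [hγ, map_one] at this
    exact this.symm
  set G := M.transpose * Matrix.diagonal d * M with hG
  have hGdet : G.det = d 0 * d 1 * d 2 := by
    rw [hG, Matrix.det_mul, Matrix.det_mul, Matrix.det_transpose, hdet, Matrix.det_diagonal,
      Fin.prod_univ_three]; ring
  have hGij (i j : Fin 3) : G i j = ∑ k, d k * γ k i * γ k j := by
    rw [hG, Matrix.mul_apply]
    refine Finset.sum_congr rfl fun k _ => ?_
    rw [Matrix.mul_diagonal, Matrix.transpose_apply, hM, Matrix.map_apply, Matrix.map_apply]; ring
  have hsymm (i j : Fin 3) : G i j = G j i := by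
    rw [hGij, hGij]; exact Finset.sum_congr rfl fun k _ => by ring
  have h00 : G 0 0 = a := by
    rw [hGij, ← hda]; exact Finset.sum_congr rfl fun k _ => by ring
  have hexp (x y z : ℝ) : ∑ i, d i * (γ i 0 * x + γ i 1 * y + γ i 2 * z) ^ 2
      = G 0 0 * x ^ 2 + G 1 1 * y ^ 2 + G 2 2 * z ^ 2
        + 2 * G 0 1 * x * y + 2 * G 0 2 * x * z + 2 * G 1 2 * y * z := by
    simp only [hGij, Fin.sum_univ_three]; ring
  rw [Matrix.det_fin_three, hsymm 1 0, hsymm 2 0, hsymm 2 1, h00] at hGdet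
  refine ⟨G 0 1 / a, G 0 2 / a, G 1 1 - G 0 1 ^ 2 / a, G 1 2 - G 0 1 * G 0 2 / a,
    G 2 2 - G 0 2 ^ 2 / a, ?_, fun x y z => ?_⟩
  · rw [← hGdet]; field_simp; ring
  · rw [hexp, h00]; field_simp; ring

theorem exists_int_vec_of_neg {d : Fin 3 → ℝ} (hκ : 0 < d 0 * d 1 * d 2) {f : ℝ} (hf : 0 < f)
    {γ : Matrix (Fin 3) (Fin 3) ℤ} (hγ : γ.det = 1)
    (hda : ∑ i, d i * (γ i 0 : ℝ) ^ 2 = -f) (s : Fin 3 → ℝ) (τ : ℝ) :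
    ∃ n : Fin 3 → ℤ, ∑ i, d i * ((n i : ℝ) + s i) ^ 2 ≤ τ ∧
      τ - (2 * √(2 * √(2 * √(d 0 * d 1 * d 2 * f) * f * |τ| + d 0 * d 1 * d 2 * f / 4)
        + 2 * √(d 0 * d 1 * d 2 * f) + f * |τ|) + f) ≤ ∑ i, d i * ((n i : ℝ) + s i) ^ 2 := by
  obtain ⟨α, β, A, B, C, hdet, hQ⟩ := exists_complete_square d hγ (neg_ne_zero.2 hf.ne') hda
  obtain ⟨s₀, s₁, s₂, hs⟩ := exists_real_preimage hγ s
  have hdet' : B ^ 2 - A * C = d 0 * d 1 * d 2 / f := by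
    rw [div_neg] at hdet; linarith
  obtain ⟨x, y, z, h1, h2⟩ := exists_triangular_form_near (α := α) (β := β) hf hκ hdet' s₀ s₁ s₂ τ
  refine ⟨fun i => γ i 0 * x + γ i 1 * y + γ i 2 * z, ?_⟩
  have e : ∑ i, d i * (((γ i 0 * x + γ i 1 * y + γ i 2 * z : ℤ) : ℝ) + s i) ^ 2
      = ∑ i, d i * (γ i 0 * (x + s₀) + γ i 1 * (y + s₁) + γ i 2 * (z + s₂)) ^ 2 := by
    refine Finset.sum_congr rfl fun i _ => ?_
    rw [hs i]; push_cast; ring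
  rw [e, hQ]
  exact ⟨h1, h2⟩

theorem exists_int_vec_neg_of_pos {d : Fin 3 → ℝ} (hκ : 0 < d 0 * d 1 * d 2) (hd1 : d 1 < 0)
    {D : ℝ} (hD : 0 < D) {γ : Matrix (Fin 3) (Fin 3) ℤ} (hγ : γ.det = 1)
    (hda : ∑ i, d i * (γ i 0 : ℝ) ^ 2 = D) :
    ∃ n : Fin 3 → ℤ, ∑ i, d i * (n i : ℝ) ^ 2 < 0 ∧
      -(D + 2 * √(2 * √(d 0 * d 1 * d 2 * D))) ≤ ∑ i, d i * (n i : ℝ) ^ 2 := by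
  obtain ⟨α, β, A, B, C, hdet, hQ⟩ := exists_complete_square d hγ hD.ne' hda
  have hκD : 0 < d 0 * d 1 * d 2 / D := div_pos hκ hD
  have hA : A < 0 := by
    by_contra! hA
    have hA' : 0 < A := by
      rcases hA.lt_or_eq with h | h
      · exact h
      · rw [← h] at hdet; nlinarith [sq_nonneg B]
    obtain ⟨x, y, z, hs⟩ := exists_real_preimage hγ ![0, 1, 0]
    have h1 := hQ x y z
    simp only [← hs, Fin.sum_univ_three] at h1
    simp only [Matrix.cons_val_zero, Matrix.cons_val_one, Matrix.cons_val] at h1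
    have h2 : A * (A * y ^ 2 + 2 * B * y * z + C * z ^ 2)
        = (A * y + B * z) ^ 2 + (A * C - B ^ 2) * z ^ 2 := by ring
    have h3 : 0 ≤ A * (A * y ^ 2 + 2 * B * y * z + C * z ^ 2) := by
      rw [h2, hdet]; positivity
    have h4 := nonneg_of_mul_nonneg_right h3 hA'
    have h5 : 0 ≤ D * (x + α * y + β * z) ^ 2 := by positivity
    linarith
  obtain ⟨x, y, z, h1, h2⟩ := exists_triangular_form_neg (α := α) (β := β) (A := -A) (B := -B)
    (C := -C) hD hκ (by linarith) (by linarith)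
  refine ⟨fun i => γ i 0 * x + γ i 1 * y + γ i 2 * z, ?_⟩
  have e : ∑ i, d i * ((γ i 0 * x + γ i 1 * y + γ i 2 * z : ℤ) : ℝ) ^ 2
      = ∑ i, d i * (γ i 0 * x + γ i 1 * y + γ i 2 * (z : ℝ)) ^ 2 := by
    push_cast; rfl
  rw [e, hQ]
  constructor <;> linarith

theorem exists_int_pair_abs_small {ξ : ℝ} (hξ : Irrational ξ) {ε : ℝ} (hε : 0 < ε) :
    ∃ x y : ℤ, x * ξ - y ≠ 0 ∧ |x * ξ - y| < ε := by
  obtain ⟨N, hN⟩ := exists_nat_one_div_lt hε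
  obtain ⟨j, k, hk0, -, hjk⟩ := Real.exists_int_int_abs_mul_sub_le ξ (Nat.succ_pos N)
  refine ⟨k, j, ?_, lt_of_le_of_lt hjk (lt_of_le_of_lt ?_ hN)⟩
  · exact sub_ne_zero.2 ((hξ.intCast_mul hk0.ne').ne_int j)
  · apply one_div_le_one_div_of_le (by positivity); push_cast; linarith

/-- An isotropic integer vector of an irrational diagonal form produces small negative values. -/
theorem exists_int_vec_neg_of_isotropic {d : Fin 3 → ℝ} (hd0 : 0 < d 0) (hd1 : d 1 < 0)
    (hd2 : d 2 < 0) (h01 : Irrational (d 0 / d 1)) (h02 : Irrational (d 0 / d 2))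
    {n : Fin 3 → ℤ} (hn : n ≠ 0) (hQ : ∑ i, d i * (n i : ℝ) ^ 2 = 0) {ε : ℝ} (hε : 0 < ε) :
    ∃ m : Fin 3 → ℤ, ∑ i, d i * (m i : ℝ) ^ 2 < 0 ∧ -ε < ∑ i, d i * (m i : ℝ) ^ 2 := by
  have hQ' := hQ
  rw [Fin.sum_univ_three] at hQ'
  have hp : n 0 ≠ 0 := by
    intro hp
    rw [hp] at hQ'
    have h1 : d 1 * (n 1 : ℝ) ^ 2 ≤ 0 := mul_nonpos_of_nonpos_of_nonneg hd1.le (sq_nonneg _)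
    have h2 : d 2 * (n 2 : ℝ) ^ 2 ≤ 0 := mul_nonpos_of_nonpos_of_nonneg hd2.le (sq_nonneg _)
    have h3 : d 1 * (n 1 : ℝ) ^ 2 = 0 := by push_cast at hQ'; linarith
    have h4 : d 2 * (n 2 : ℝ) ^ 2 = 0 := by push_cast at hQ'; linarith
    have h5 : n 1 = 0 := by simpa [hd1.ne] using h3
    have h6 : n 2 = 0 := by simpa [hd2.ne] using h4
    exact hn (by ext i; fin_cases i <;> assumption)
  -- a vector with small nonzero polar value
  have hB : ∃ m : Fin 3 → ℤ, ∑ i, d i * (m i : ℝ) * n i ≠ 0 ∧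
      |∑ i, d i * (m i : ℝ) * n i| < ε / 2 := by
    have aux (k : Fin 3) (hk : k ≠ 0) (hdk : d k < 0) (hirr : Irrational (d 0 / d k))
        (hnk : n k ≠ 0) : ∃ m : Fin 3 → ℤ, ∑ i, d i * (m i : ℝ) * n i ≠ 0 ∧
        |∑ i, d i * (m i : ℝ) * n i| < ε / 2 := by
      have hn0 : (n 0 : ℝ) ≠ 0 := by exact_mod_cast hp
      have hnk' : (n k : ℝ) ≠ 0 := by exact_mod_cast hnk
      have hξ : Irrational (d 0 / d k * n 0 / n k) :=
        (hirr.mul_intCast hp).div_intCast hnk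
      have hpos : 0 < |d k * n k| := abs_pos.2 (mul_ne_zero hdk.ne hnk')
      obtain ⟨x, y, h1, h2⟩ := exists_int_pair_abs_small hξ
        (div_pos (half_pos hε) hpos)
      refine ⟨Pi.single 0 x + Pi.single k (-y), ?_⟩
      have e : ∑ i, d i * ((Pi.single 0 x + Pi.single k (-y) : Fin 3 → ℤ) i : ℝ) * n i
          = d k * n k * (x * (d 0 / d k * n 0 / n k) - y) := by
        have : ∑ i, d i * ((Pi.single 0 x + Pi.single k (-y) : Fin 3 → ℤ) i : ℝ) * n i
            = d 0 * x * n 0 - d k * y * n k := by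
          fin_cases k
          · exact absurd rfl hk
          · simp [Fin.sum_univ_three]; ring
          · simp [Fin.sum_univ_three]; ring
        rw [this]
        have := hdk.ne
        field_simp
      rw [e]
      refine ⟨mul_ne_zero (mul_ne_zero hdk.ne hnk') h1, ?_⟩
      rw [abs_mul]
      rwa [lt_div_iff₀ hpos, mul_comm] at h2
    by_cases hq : n 1 = 0
    · refine aux 2 (by decide) hd2 h02 fun hr => ?_
      rw [hq, hr] at hQ'
      have : d 0 * (n 0 : ℝ) ^ 2 = 0 := by push_cast at hQ'; linarith
      exact hp (by simpa [hd0.ne'] using this)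
    · exact aux 1 (by decide) hd1 h01 hq
  obtain ⟨m, hm0, hmε⟩ := hB
  set b := ∑ i, d i * (m i : ℝ) * n i with hb
  set c := ∑ i, d i * (m i : ℝ) ^ 2 with hc
  have hexp (j : ℤ) : ∑ i, d i * ((m + j • n) i : ℝ) ^ 2 = c + 2 * b * j := by
    have : ∑ i, d i * ((m + j • n) i : ℝ) ^ 2
        = c + 2 * b * j + j ^ 2 * ∑ i, d i * (n i : ℝ) ^ 2 := by
      rw [hc, hb, Finset.mul_sum, Finset.mul_sum, Finset.sum_mul, ← Finset.sum_add_distrib,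
        ← Finset.sum_add_distrib]
      refine Finset.sum_congr rfl fun i _ => ?_
      simp only [Pi.add_apply, Pi.smul_apply, smul_eq_mul]; push_cast; ring
    rw [this, hQ]; ring
  obtain ⟨k, hk1, hk2⟩ := exists_int_add_mem_Ico (c / (2 * |b|)) (-1)
  have hb0 : 0 < |b| := abs_pos.2 hm0
  have hcb : 2 * |b| * (c / (2 * |b|)) = c := by field_simp
  have key (j : ℤ) (hj : b * j = |b| * k) : ∃ m : Fin 3 → ℤ,
      ∑ i, d i * (m i : ℝ) ^ 2 < 0 ∧ -ε < ∑ i, d i * (m i : ℝ) ^ 2 := by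
    refine ⟨m + j • n, ?_⟩
    rw [hexp, show c + 2 * b * j = 2 * |b| * (k + c / (2 * |b|)) by
      rw [mul_add, hcb]; linear_combination 2 * hj]
    constructor <;> nlinarith
  rcases abs_cases b with ⟨h, -⟩ | ⟨h, -⟩
  · exact key k (by rw [h])
  · exact key (-k) (by rw [h]; push_cast; ring)

theorem exists_pos_le_abs_of_not_dense {d : Fin 3 → ℝ} (hd0 : 0 < d 0) (hd1 : d 1 < 0)
    (hd2 : d 2 < 0) (h01 : Irrational (d 0 / d 1)) (h02 : Irrational (d 0 / d 2))
    {s : Fin 3 → ℝ}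
    (hs : ¬ Dense {t : ℝ | ∃ n : Fin 3 → ℤ, ∑ i, d i * ((n i : ℝ) + s i) ^ 2 = t}) :
    ∃ δ : ℝ, 0 < δ ∧ ∀ n : Fin 3 → ℤ, n ≠ 0 → δ ≤ |∑ i, d i * (n i : ℝ) ^ 2| := by
  have hκ : 0 < d 0 * d 1 * d 2 := mul_pos_of_neg_of_neg (mul_neg_of_pos_of_neg hd0 hd1) hd2
  contrapose! hs
  have hcol {n : Fin 3 → ℤ} {γ : Matrix (Fin 3) (Fin 3) ℤ} {h : ℤ} (hn : ∀ i, n i = h * γ i 0) :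
      ∑ i, d i * (n i : ℝ) ^ 2 = h ^ 2 * ∑ i, d i * (γ i 0 : ℝ) ^ 2 := by
    rw [Finset.mul_sum]
    refine Finset.sum_congr rfl fun i _ => ?_
    rw [hn]; push_cast; ring
  have hle {n : Fin 3 → ℤ} {γ : Matrix (Fin 3) (Fin 3) ℤ} {h : ℤ} (hn : ∀ i, n i = h * γ i 0)
      (h0 : ∑ i, d i * (n i : ℝ) ^ 2 ≠ 0) :
      |∑ i, d i * (γ i 0 : ℝ) ^ 2| ≤ |∑ i, d i * (n i : ℝ) ^ 2| := by
    have hh : h ≠ 0 := by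
      rintro rfl
      rw [hcol hn] at h0; simp at h0
    rw [hcol hn, abs_mul]
    apply le_mul_of_one_le_left (abs_nonneg _)
    rw [abs_of_nonneg (by positivity)]
    have : 1 ≤ h ^ 2 := Int.add_one_le_iff.2 (sq_pos_of_ne_zero hh)
    exact_mod_cast this
  have hneg : ∀ ε > 0, ∃ m : Fin 3 → ℤ,
      ∑ i, d i * (m i : ℝ) ^ 2 < 0 ∧ -ε < ∑ i, d i * (m i : ℝ) ^ 2 := by
    intro ε hε
    have hlim : Tendsto (fun D : ℝ => D + 2 * √(2 * √(d 0 * d 1 * d 2 * D))) (𝓝 0) (𝓝 0) := by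
      have : Continuous fun D : ℝ => D + 2 * √(2 * √(d 0 * d 1 * d 2 * D)) := by fun_prop
      simpa using this.tendsto 0
    obtain ⟨δ, hδ, hδε⟩ := Metric.tendsto_nhds_nhds.1 hlim ε hε
    obtain ⟨n, hn0, hn⟩ := hs (min δ ε) (lt_min hδ hε)
    rw [lt_min_iff] at hn
    rcases lt_trichotomy (∑ i, d i * (n i : ℝ) ^ 2) 0 with h | h | h
    · exact ⟨n, h, by linarith [neg_le_abs (∑ i, d i * (n i : ℝ) ^ 2)]⟩
    · exact exists_int_vec_neg_of_isotropic hd0 hd1 hd2 h01 h02 hn0 h hε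
    · obtain ⟨γ, g, hγ, hγn⟩ := exists_det_one_first_column n
      have hD : 0 < ∑ i, d i * (γ i 0 : ℝ) ^ 2 := by
        rw [hcol hγn] at h
        exact pos_of_mul_pos_right h (sq_nonneg _)
      obtain ⟨m, h1, h2⟩ := exists_int_vec_neg_of_pos hκ hd1 hD hγ rfl
      refine ⟨m, h1, lt_of_lt_of_le ?_ h2⟩
      have h3 := hδε (x := ∑ i, d i * (γ i 0 : ℝ) ^ 2) (by
        rw [Real.dist_eq, sub_zero]; exact (hle hγn h.ne').trans_lt hn.1)
      rw [Real.dist_eq, sub_zero] at h3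
      exact neg_lt_neg ((le_abs_self _).trans_lt h3)
  rw [Metric.dense_iff]
  intro τ ε hε
  have hlim : Tendsto (fun f : ℝ => 2 * √(2 * √(2 * √(d 0 * d 1 * d 2 * f) * f * |τ|
      + d 0 * d 1 * d 2 * f / 4) + 2 * √(d 0 * d 1 * d 2 * f) + f * |τ|) + f)
      (𝓝 0) (𝓝 0) := by
    have : Continuous fun f : ℝ => 2 * √(2 * √(2 * √(d 0 * d 1 * d 2 * f) * f * |τ|
      + d 0 * d 1 * d 2 * f / 4) + 2 * √(d 0 * d 1 * d 2 * f) + f * |τ|) + f := by fun_prop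
    simpa using this.tendsto 0
  obtain ⟨δ, hδ, hδε⟩ := Metric.tendsto_nhds_nhds.1 hlim ε hε
  obtain ⟨b, hb0, hb⟩ := hneg δ hδ
  obtain ⟨γ, g, hγ, hγn⟩ := exists_det_one_first_column b
  have hf : 0 < -∑ i, d i * (γ i 0 : ℝ) ^ 2 := by
    rw [hcol hγn] at hb0
    by_contra! h
    exact absurd hb0 (not_lt.2 (mul_nonneg (sq_nonneg _) (by linarith)))
  obtain ⟨n, h1, h2⟩ := exists_int_vec_of_neg hκ hf hγ (neg_neg _).symm s τ
  refine ⟨_, ?_, n, rfl⟩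
  have h3 := hδε (x := -∑ i, d i * (γ i 0 : ℝ) ^ 2) (by
    rw [Real.dist_eq, sub_zero, abs_neg]
    refine (hle hγn hb0.ne).trans_lt ?_
    rw [abs_of_neg hb0]; linarith)
  rw [Real.dist_eq, sub_zero] at h3
  have h4 := (le_abs_self _).trans_lt h3
  rw [Metric.mem_ball, Real.dist_eq, abs_lt]
  constructor <;> linarith

end

section

open Matrix Filter Topology

/-- A Gram determinant bounds the largest diagonal entry of an almost reduced Gram matrix. -/
theorem mul_le_gram_det_of_reduced {a b c x y z δ : ℝ} (hδ : 0 < δ) (ha : δ ≤ a) (hab : a ≤ b)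
    (hbc : b ≤ c) (hv : ∀ k : ℤ, b - δ / 10 ≤ b + 2 * k * x + k ^ 2 * a)
    (hw : ∀ k l : ℤ,
      c - δ / 10 ≤ c + k ^ 2 * a + l ^ 2 * b + 2 * k * y + 2 * l * z + 2 * k * l * x) :
    2 / 25 * δ ^ 2 * c ≤ a * b * c + 2 * x * y * z - a * z ^ 2 - b * y ^ 2 - c * x ^ 2 := by
  have h1 := hv 1
  have h2 := hv (-1)
  push_cast at h1 h2
  have ha0 : 0 < a := hδ.trans_le ha
  have hb0 : 0 < b := ha0.trans_le hab
  have hx : |x| ≤ 11 / 20 * a := by rw [abs_le]; constructor <;> linarith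
  have hx2 : x ^ 2 ≤ 121 / 400 * (a * b) := by
    rw [← sq_abs]
    calc |x| ^ 2 ≤ (11 / 20 * a) ^ 2 := by gcongr
      _ = 121 / 400 * (a * a) := by ring
      _ ≤ 121 / 400 * (a * b) := by gcongr
  set g := a * b - x ^ 2 with hg
  have hgle : 279 / 400 * (a * b) ≤ g := by linarith
  have hg0 : 0 < g := lt_of_lt_of_le (by positivity) hgle
  set G := a * b * c + 2 * x * y * z - a * z ^ 2 - b * y ^ 2 - c * x ^ 2 with hG
  set α := (y * b - z * x) / g with hα
  set β := (z * a - y * x) / g with hβ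
  set k := round (-α) with hk
  set l := round (-β) with hl
  have hkα : |(k : ℝ) + α| ≤ 1 / 2 := by
    have := abs_sub_round (-α)
    rwa [← hk, abs_sub_comm, sub_neg_eq_add] at this
  have hlβ : |(l : ℝ) + β| ≤ 1 / 2 := by
    have := abs_sub_round (-β)
    rwa [← hl, abs_sub_comm, sub_neg_eq_add] at this
  have e : c + k ^ 2 * a + l ^ 2 * b + 2 * k * y + 2 * l * z + 2 * k * l * x
      = G / g + ((k + α) ^ 2 * a + (l + β) ^ 2 * b + 2 * ((k + α) * (l + β)) * x) := by
    have hgg : a * b - x ^ 2 ≠ 0 := hg0.ne'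
    rw [hα, hβ, hG, hg]; field_simp; ring
  have h3 := hw k l
  rw [e] at h3
  have h4 : ((k : ℝ) + α) ^ 2 ≤ 1 / 4 := by
    rw [← sq_abs]
    calc |(k : ℝ) + α| ^ 2 ≤ (1 / 2) ^ 2 := by gcongr
      _ = 1 / 4 := by norm_num
  have h5 : ((l : ℝ) + β) ^ 2 ≤ 1 / 4 := by
    rw [← sq_abs]
    calc |(l : ℝ) + β| ^ 2 ≤ (1 / 2) ^ 2 := by gcongr
      _ = 1 / 4 := by norm_num
  have h6 : ((k : ℝ) + α) * (l + β) * x ≤ 1 / 2 * (1 / 2) * (11 / 20 * a) := by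
    refine (le_abs_self _).trans ?_
    rw [abs_mul, abs_mul]
    gcongr
  have h7 : ((k : ℝ) + α) ^ 2 * a ≤ 1 / 4 * a := by gcongr
  have h8 : ((l : ℝ) + β) ^ 2 * b ≤ 1 / 4 * b := by gcongr
  have h9 : c / 8 ≤ G / g := by linarith
  rw [le_div_iff₀ hg0] at h9
  have h10 : δ * δ ≤ a * b := by gcongr; linarith
  have h11 : c / 8 * (279 / 400 * (δ * δ)) ≤ c / 8 * g := by
    have : 0 < c := hb0.trans_le hbc
    gcongr; linarith
  have : 0 ≤ c * (δ * δ) := by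
    have : 0 < c := hb0.trans_le hbc
    positivity
  linarith

theorem det_sq_eq_gram (M : Matrix (Fin 3) (Fin 3) ℝ) (i j k : Fin 3) (hij : i ≠ j) (hik : i ≠ k)
    (hjk : j ≠ k) :
    M.det ^ 2 = (∑ r, M r i ^ 2) * (∑ r, M r j ^ 2) * (∑ r, M r k ^ 2)
      + 2 * (∑ r, M r i * M r j) * (∑ r, M r i * M r k) * (∑ r, M r j * M r k)
      - (∑ r, M r i ^ 2) * (∑ r, M r j * M r k) ^ 2
      - (∑ r, M r j ^ 2) * (∑ r, M r i * M r k) ^ 2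
      - (∑ r, M r k ^ 2) * (∑ r, M r i * M r j) ^ 2 := by
  rw [Matrix.det_fin_three]
  simp only [Fin.sum_univ_three]
  fin_cases i <;> fin_cases j <;> fin_cases k <;>
    first
    | exact absurd rfl hij
    | exact absurd rfl hik
    | exact absurd rfl hjk
    | (simp only [Fin.zero_eta, Fin.mk_one, Fin.reduceFinMk]; ring)

theorem exists_reduced_basis (B : Matrix (Fin 3) (Fin 3) ℝ) {δ : ℝ} (hδ : 0 < δ)
    (hB : ∀ n : Fin 3 → ℤ, n ≠ 0 → δ ≤ ∑ r, (∑ i, B r i * n i) ^ 2) :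
    ∃ γ : Matrix (Fin 3) (Fin 3) ℤ, γ.det = 1 ∧
      ∀ j, 2 / 25 * δ ^ 2 * ∑ r, (∑ i, B r i * (γ i j : ℝ)) ^ 2 ≤ B.det ^ 2 := by
  set E : Matrix (Fin 3) (Fin 3) ℤ → ℝ := fun γ => ∑ j, ∑ r, (∑ i, B r i * (γ i j : ℝ)) ^ 2
    with hE
  have hne : (E '' {γ | γ.det = 1}).Nonempty := ⟨_, 1, Matrix.det_one, rfl⟩
  have hbdd : BddBelow (E '' {γ | γ.det = 1}) := by
    refine ⟨0, ?_⟩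
    rintro _ ⟨γ, -, rfl⟩
    simp only [hE]; positivity
  obtain ⟨_, ⟨γ, hγ, rfl⟩, hlt⟩ := exists_lt_of_csInf_lt hne
    (lt_add_of_pos_right (sInf (E '' {γ | γ.det = 1})) (show 0 < δ / 10 by positivity))
  have hmin (γ' : Matrix (Fin 3) (Fin 3) ℤ) (hγ' : γ'.det = 1) : E γ ≤ E γ' + δ / 10 := by
    linarith [csInf_le hbdd (Set.mem_image_of_mem E hγ')]
  refine ⟨γ, hγ, ?_⟩
  set M : Matrix (Fin 3) (Fin 3) ℝ := B * γ.map (Int.cast : ℤ → ℝ) with hM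
  have hMr (r j : Fin 3) : ∑ i, B r i * (γ i j : ℝ) = M r j := rfl
  have hdet : M.det = B.det := by
    have := (Int.castRingHom ℝ).map_det γ
    rw [hγ, map_one] at this
    rw [hM, Matrix.det_mul]
    exact (congrArg _ this.symm).trans (mul_one _)
  simp only [hMr]
  rw [← hdet]
  have hEγ : E γ = ∑ j, ∑ r, M r j ^ 2 := rfl
  have hcol (j : Fin 3) : δ ≤ ∑ r, M r j ^ 2 := by
    refine hB (fun i => γ i j) fun h => ?_
    have : γ.det = 0 := Matrix.det_eq_zero_of_column_eq_zero j fun i => congrFun h i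
    rw [hγ] at this; exact one_ne_zero this
  have hred (i j k : Fin 3) (hij : i ≠ j) (hik : i ≠ k) (hjk : j ≠ k) (m l : ℤ) :
      ∑ r, M r i ^ 2 - δ / 10 ≤ ∑ r, M r i ^ 2 + m ^ 2 * ∑ r, M r j ^ 2 + l ^ 2 * ∑ r, M r k ^ 2
        + 2 * m * ∑ r, M r j * M r i + 2 * l * ∑ r, M r k * M r i
        + 2 * m * l * ∑ r, M r j * M r k := by
    set γ₁ := γ.updateCol i fun r => γ r i + m • γ r j with hγ₁
    have hdet₁ : γ₁.det = 1 := by rw [hγ₁, Matrix.det_updateCol_add_smul_self _ hij, hγ]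
    set γ₂ := γ₁.updateCol i fun r => γ₁ r i + l • γ₁ r k with hγ₂
    have hdet₂ : γ₂.det = 1 := by rw [hγ₂, Matrix.det_updateCol_add_smul_self _ hik, hdet₁]
    have h1 (r : Fin 3) : γ₂ r i = γ r i + m * γ r j + l * γ r k := by
      simp [hγ₂, hγ₁, hik.symm]
    have h2 (r q : Fin 3) (hq : q ≠ i) : γ₂ r q = γ r q := by
      simp [hγ₂, hγ₁, hq]
    have h3 (r : Fin 3) : ∑ s, B r s * (γ₂ s i : ℝ) = M r i + m * M r j + l * M r k := by
      simp only [h1, ← hMr, Finset.mul_sum, ← Finset.sum_add_distrib]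
      refine Finset.sum_congr rfl fun s _ => ?_
      push_cast; ring
    have h4 (r q : Fin 3) (hq : q ≠ i) : ∑ s, B r s * (γ₂ s q : ℝ) = M r q := by
      simp only [h2 _ q hq, ← hMr]
    have h5 := hmin γ₂ hdet₂
    rw [hEγ] at h5
    simp only [hE] at h5
    rw [← Finset.add_sum_erase _ _ (Finset.mem_univ i),
      ← Finset.add_sum_erase Finset.univ (fun j => ∑ r, (∑ s, B r s * (γ₂ s j : ℝ)) ^ 2)
        (Finset.mem_univ i)] at h5
    rw [Finset.sum_congr rfl fun q hq => Finset.sum_congr rfl fun r _ =>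
      congrArg (· ^ 2) (h4 r q (Finset.ne_of_mem_erase hq))] at h5
    simp only [h3] at h5
    have h6 : ∑ r, (M r i + m * M r j + l * M r k) ^ 2
        = ∑ r, M r i ^ 2 + m ^ 2 * ∑ r, M r j ^ 2 + l ^ 2 * ∑ r, M r k ^ 2
        + 2 * m * ∑ r, M r j * M r i + 2 * l * ∑ r, M r k * M r i
        + 2 * m * l * ∑ r, M r j * M r k := by
      simp only [Finset.mul_sum, ← Finset.sum_add_distrib]
      exact Finset.sum_congr rfl fun r _ => by ring
    rw [h6] at h5
    linarith
  have core (i j k : Fin 3) (hij : i ≠ j) (hik : i ≠ k) (hjk : j ≠ k)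
      (h1 : ∑ r, M r i ^ 2 ≤ ∑ r, M r j ^ 2) (h2 : ∑ r, M r j ^ 2 ≤ ∑ r, M r k ^ 2) :
      ∀ q, 2 / 25 * δ ^ 2 * ∑ r, M r q ^ 2 ≤ M.det ^ 2 := by
    have hk : 2 / 25 * δ ^ 2 * ∑ r, M r k ^ 2 ≤ M.det ^ 2 := by
      rw [det_sq_eq_gram M i j k hij hik hjk]
      refine mul_le_gram_det_of_reduced hδ (hcol i) h1 h2 (fun m => ?_) (fun m l => ?_)
      · have := hred j i k hij.symm hjk hik m 0
        push_cast at this; linarith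
      · exact hred k i j hik.symm hjk.symm hij m l
    intro q
    refine le_trans ?_ hk
    gcongr 2 / 25 * δ ^ 2 * ?_
    have : q = i ∨ q = j ∨ q = k := by omega
    rcases this with rfl | rfl | rfl
    · exact h1.trans h2
    · exact h2
    · exact le_rfl
  rcases le_total (∑ r, M r 0 ^ 2) (∑ r, M r 1 ^ 2) with h01 | h01 <;>
  rcases le_total (∑ r, M r 0 ^ 2) (∑ r, M r 2 ^ 2) with h02 | h02 <;>
  rcases le_total (∑ r, M r 1 ^ 2) (∑ r, M r 2 ^ 2) with h12 | h12
  · exact core 0 1 2 (by decide) (by decide) (by decide) h01 h12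
  · exact core 0 2 1 (by decide) (by decide) (by decide) h02 h12
  · exact core 2 0 1 (by decide) (by decide) (by decide) h02 h01
  · exact core 2 0 1 (by decide) (by decide) (by decide) h02 h01
  · exact core 1 0 2 (by decide) (by decide) (by decide) h01 h02
  · exact core 1 0 2 (by decide) (by decide) (by decide) h01 h02
  · exact core 1 2 0 (by decide) (by decide) (by decide) h12 h02
  · exact core 2 1 0 (by decide) (by decide) (by decide) h12 h01

/-- Square matrices of size four. -/
abbrev Mat4 (R : Type*) := Matrix (Fin 4) (Fin 4) R

/-- The matrix of the isotropic form `2 x z - y ^ 2` on the first three coordinates. -/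
def isoForm : Mat4 ℝ := !![0, 0, 1, 0; 0, -1, 0, 0; 1, 0, 0, 0; 0, 0, 0, 0]

/-- The value at `v` of the quadratic form with matrix `S`. -/
def quadVal (S : Mat4 ℝ) (v : Fin 4 → ℝ) : ℝ := v ⬝ᵥ S *ᵥ v

/-- A matrix acts affinely on the first three coordinates if its last row is that of `1`. -/
def IsAffine {R : Type*} [Zero R] [One R] (A : Mat4 R) : Prop := ∀ j, A 3 j = (1 : Mat4 R) 3 j

/-- The integral unimodular affine matrices. -/
def affineSL : Set (Mat4 ℤ) := {γ | γ.det = 1 ∧ IsAffine γ}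

/-- The real matrix with the given integer entries. -/
abbrev castMat : Mat4 ℤ →+* Mat4 ℝ := (Int.castRingHom ℝ).mapMatrix

/-- The real vector with the given integer entries. -/
def castVec (n : Fin 4 → ℤ) : Fin 4 → ℝ := fun i => n i

theorem castMat_apply (γ : Mat4 ℤ) (i j : Fin 4) : castMat γ i j = γ i j := rfl

theorem quadVal_mulVec (S A : Mat4 ℝ) (v : Fin 4 → ℝ) :
    quadVal S (A *ᵥ v) = quadVal (Aᵀ * S * A) v := by
  rw [quadVal, quadVal, ← Matrix.mulVec_mulVec, ← Matrix.mulVec_mulVec,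
    Matrix.dotProduct_mulVec v, Matrix.vecMul_transpose]

theorem quadVal_isoForm (v : Fin 4 → ℝ) : quadVal isoForm v = 2 * v 0 * v 2 - v 1 ^ 2 := by
  simp [quadVal, isoForm, Matrix.mulVec, dotProduct, Fin.sum_univ_four]
  ring

theorem abs_quadVal_isoForm_le (v : Fin 4 → ℝ) :
    |quadVal isoForm v| ≤ v 0 ^ 2 + v 1 ^ 2 + v 2 ^ 2 := by
  rw [quadVal_isoForm, abs_le]
  constructor <;> nlinarith [sq_nonneg (v 0 + v 2), sq_nonneg (v 0 - v 2), sq_nonneg (v 1)]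

theorem IsAffine.mul_apply {R : Type*} [CommRing R] {A : Mat4 R} (hA : IsAffine A) (B : Mat4 R)
    (j : Fin 4) : (A * B) 3 j = B 3 j := by
  have : (A * B) 3 j = ((1 : Mat4 R) * B) 3 j := by
    rw [Matrix.mul_apply, Matrix.mul_apply]
    exact Finset.sum_congr rfl fun k _ => by rw [hA]
  rw [this, one_mul]

theorem IsAffine.mul {R : Type*} [CommRing R] {A B : Mat4 R} (hA : IsAffine A)
    (hB : IsAffine B) : IsAffine (A * B) := fun j => by
  rw [hA.mul_apply, hB]

theorem IsAffine.mulVec_apply {R : Type*} [CommRing R] {A : Mat4 R} (hA : IsAffine A)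
    (v : Fin 4 → R) : (A *ᵥ v) 3 = v 3 := by
  have : (A *ᵥ v) 3 = ((1 : Mat4 R) *ᵥ v) 3 := by
    rw [Matrix.mulVec, Matrix.mulVec, dotProduct, dotProduct]
    exact Finset.sum_congr rfl fun k _ => by rw [hA]
  rw [this, Matrix.one_mulVec]

theorem IsAffine.castMat {γ : Mat4 ℤ} (hγ : IsAffine γ) : IsAffine (castMat γ) := fun j => by
  rw [castMat_apply, hγ j, Matrix.one_apply, Matrix.one_apply]
  split_ifs <;> simp

theorem one_mem_affineSL : (1 : Mat4 ℤ) ∈ affineSL := ⟨Matrix.det_one, fun _ => rfl⟩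

theorem mul_mem_affineSL {γ η : Mat4 ℤ} (hγ : γ ∈ affineSL) (hη : η ∈ affineSL) :
    γ * η ∈ affineSL :=
  ⟨by rw [Matrix.det_mul, hγ.1, hη.1, one_mul], hγ.2.mul hη.2⟩

theorem exists_inv_affineSL {γ : Mat4 ℤ} (hγ : γ ∈ affineSL) :
    ∃ η ∈ affineSL, γ * η = 1 ∧ η * γ = 1 := by
  have h1 : γ * γ.adjugate = 1 := by rw [Matrix.mul_adjugate, hγ.1, one_smul]
  refine ⟨γ.adjugate, ⟨by rw [Matrix.det_adjugate, hγ.1, one_pow], fun j => ?_⟩, h1, ?_⟩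
  · exact (hγ.2.mul_apply γ.adjugate j).symm.trans (by rw [h1])
  · rw [Matrix.adjugate_mul, hγ.1, one_smul]

theorem castMat_mulVec (γ : Mat4 ℤ) (n : Fin 4 → ℤ) :
    castMat γ *ᵥ castVec n = castVec (γ *ᵥ n) := by
  ext i
  simp [Matrix.mulVec, dotProduct, castVec, castMat_apply]

theorem det_castMat {γ : Mat4 ℤ} (hγ : γ ∈ affineSL) : (castMat γ).det = 1 := by
  have := (Int.castRingHom ℝ).map_det γ
  rw [hγ.1, map_one] at this
  exact this.symm

theorem mulVec_ne_zero_of_affineSL {γ : Mat4 ℤ} (hγ : γ ∈ affineSL) {n : Fin 4 → ℤ}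
    (hn : n ≠ 0) : γ *ᵥ n ≠ 0 := by
  obtain ⟨η, -, -, h⟩ := exists_inv_affineSL hγ
  intro h0
  apply hn
  rw [← Matrix.one_mulVec n, ← h, ← Matrix.mulVec_mulVec, h0, Matrix.mulVec_zero]

/-- The affine matrix with given linear part and translation. -/
def affineMat {R : Type*} [Zero R] [One R] (B : Matrix (Fin 3) (Fin 3) R) (τ : Fin 3 → R) :
    Mat4 R :=
  !![B 0 0, B 0 1, B 0 2, τ 0; B 1 0, B 1 1, B 1 2, τ 1; B 2 0, B 2 1, B 2 2, τ 2; 0, 0, 0, 1]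

theorem isAffine_affineMat {R : Type*} [Zero R] [One R] (B : Matrix (Fin 3) (Fin 3) R)
    (τ : Fin 3 → R) : IsAffine (affineMat B τ) := fun j => by
  fin_cases j <;> simp [affineMat, Matrix.one_apply]

theorem det_affineMat {R : Type*} [CommRing R] (B : Matrix (Fin 3) (Fin 3) R) (τ : Fin 3 → R) :
    (affineMat B τ).det = B.det := by
  simp [affineMat, Matrix.det_succ_row_zero, Fin.sum_univ_succ, Fin.succAbove]

theorem IsAffine.eq_affineMat {R : Type*} [Zero R] [One R] {A : Mat4 R} (hA : IsAffine A) :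
    A = affineMat (A.submatrix Fin.castSucc Fin.castSucc) fun i => A i.castSucc 3 := by
  have h0 := hA 0
  have h1 := hA 1
  have h2 := hA 2
  have h3 := hA 3
  simp at h0 h1 h2 h3
  ext i j
  fin_cases i <;> fin_cases j <;> simp [affineMat, h0, h1, h2, h3]

/-- Reduction theory: affine lattices without short vectors have bounded bases. -/
theorem exists_affineSL_bounded {c δ : ℝ} (hc : c ≠ 0) (hδ : 0 < δ) :
    ∃ C : ℝ, ∀ A : Mat4 ℝ, IsAffine A → A.det = c →
      (∀ n : Fin 4 → ℤ, n 3 = 0 → n ≠ 0 → δ ≤ |quadVal isoForm (A *ᵥ castVec n)|) →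
      ∃ γ ∈ affineSL, ∀ i j, |(A * castMat γ) i j| ≤ C := by
  set R := √(c ^ 2 / (2 / 25 * δ ^ 2)) with hR
  have hR0 : 0 ≤ R := Real.sqrt_nonneg _
  refine ⟨3 * R + 1, fun A hA hAc hAδ => ?_⟩
  obtain ⟨B, ξ, rfl⟩ : ∃ B ξ, A = affineMat B ξ := ⟨_, _, hA.eq_affineMat⟩
  rw [det_affineMat] at hAc
  obtain ⟨γ, hγ, hγB⟩ := exists_reduced_basis B hδ fun n hn => by
    refine (hAδ ![n 0, n 1, n 2, 0] rfl fun h => hn ?_).trans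
      ((abs_quadVal_isoForm_le _).trans_eq ?_)
    · ext i
      have h0 := congrFun h 0
      have h1 := congrFun h 1
      have h2 := congrFun h 2
      fin_cases i
      · exact h0
      · exact h1
      · exact h2
    · simp [affineMat, Matrix.mulVec, dotProduct, Fin.sum_univ_succ, castVec]
      ring
  set M : Matrix (Fin 3) (Fin 3) ℝ := B * γ.map (Int.cast : ℤ → ℝ) with hM
  have hMdet : M.det = c := by
    have := (Int.castRingHom ℝ).map_det γ
    rw [hγ, map_one] at this
    rw [hM, Matrix.det_mul, hAc]
    exact (congrArg _ this.symm).trans (mul_one _)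
  have hMR (i j : Fin 3) : |M i j| ≤ R := by
    apply Real.abs_le_sqrt
    rw [le_div_iff₀ (by positivity), mul_comm, ← hAc]
    refine le_trans ?_ (hγB j)
    gcongr
    exact Finset.single_le_sum (f := fun r => M r j ^ 2) (fun r _ => sq_nonneg _)
      (Finset.mem_univ i)
  set t : Fin 3 → ℝ := M⁻¹ *ᵥ ξ with ht
  have hMt : M *ᵥ t = ξ := by
    rw [ht, Matrix.mulVec_mulVec, Matrix.mul_nonsing_inv _ (by rw [hMdet]; exact hc.isUnit),
      Matrix.one_mulVec]
  set τ : Fin 3 → ℤ := fun i => -round (t i) with hτ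
  refine ⟨affineMat (γ) (γ *ᵥ τ), ⟨by rw [det_affineMat, hγ], isAffine_affineMat _ _⟩, ?_⟩
  have hmul : affineMat B ξ * castMat (affineMat γ (γ *ᵥ τ))
      = affineMat M (M *ᵥ fun i => t i + τ i) := by
    have h1 : M *ᵥ (fun i => t i + τ i) = ξ + M *ᵥ fun i => (τ i : ℝ) := by
      rw [← hMt, ← Matrix.mulVec_add]; rfl
    rw [h1]
    ext i j
    fin_cases i <;> fin_cases j <;>
      simp [affineMat, hM, Matrix.mul_apply, Fin.sum_univ_succ, Matrix.mulVec, dotProduct] <;> ring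
  rw [hmul]
  have hτt (i : Fin 3) : |t i + τ i| ≤ 1 := by
    have := abs_sub_round (t i)
    simp only [hτ]; push_cast
    rw [← sub_eq_add_neg]; linarith
  have hlast (i : Fin 3) : |(M *ᵥ fun i => t i + τ i) i| ≤ 3 * R := by
    rw [Matrix.mulVec, dotProduct]
    refine (Finset.abs_sum_le_sum_abs _ _).trans ?_
    calc ∑ j, |M i j * (t j + τ j)| ≤ ∑ _j : Fin 3, R := by
          refine Finset.sum_le_sum fun j _ => ?_
          rw [abs_mul, ← mul_one R]
          exact mul_le_mul (hMR i j) (hτt j) (abs_nonneg _) hR0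
      _ = 3 * R := by simp
  have hMR' (i j : Fin 3) : |M i j| ≤ 3 * R + 1 := (hMR i j).trans (by linarith)
  have hlast' (i : Fin 3) : |(M *ᵥ fun i => t i + τ i) i| ≤ 3 * R + 1 :=
    (hlast i).trans (by linarith)
  intro i j
  generalize (M *ᵥ fun i => t i + τ i) = η at hlast'
  fin_cases i <;> fin_cases j <;> simp only [affineMat] <;>
    first
    | exact hMR' _ _
    | exact hlast' _
    | (simp; positivity)

attribute [local instance] Matrix.normedAddCommGroup Matrix.normedSpace

/-- The affine isometries of `isoForm` of determinant one. -/
def isoGroup : Set (Mat4 ℝ) := {h | IsAffine h ∧ h.det = 1 ∧ hᵀ * isoForm * h = isoForm}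

noncomputable section

/-- The nilpotent generator of a unipotent group of isometries of `isoForm`. -/
def nilGen : Mat4 ℝ := !![0, 1, 0, 0; 0, 0, 1, 0; 0, 0, 0, 0; 0, 0, 0, 0]

/-- The unipotent flow generated by `nilGen`. -/
def uni (t : ℝ) : Mat4 ℝ := !![1, t, t ^ 2 / 2, 0; 0, 1, t, 0; 0, 0, 1, 0; 0, 0, 0, 1]

end

theorem uni_add (s t : ℝ) : uni (s + t) = uni s * uni t := by
  ext i j
  fin_cases i <;> fin_cases j <;> simp [uni, Matrix.mul_apply, Fin.sum_univ_four] <;> ring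

theorem uni_zero : uni 0 = 1 := by
  ext i j
  fin_cases i <;> fin_cases j <;> simp [uni]

theorem uni_eq (t : ℝ) : uni t = 1 + t • nilGen + (t ^ 2 / 2) • (nilGen * nilGen) := by
  ext i j
  fin_cases i <;> fin_cases j <;> simp [uni, nilGen]

theorem nilGen_cube : nilGen * nilGen * nilGen = 0 := by
  ext i j
  fin_cases i <;> fin_cases j <;> simp [nilGen, Matrix.mul_apply, Fin.sum_univ_four]

theorem uni_mem_isoGroup (t : ℝ) : uni t ∈ isoGroup := by
  refine ⟨fun j => ?_, ?_, ?_⟩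
  · fin_cases j <;> simp [uni, Matrix.one_apply]
  · simp [uni, Matrix.det_succ_row_zero, Fin.sum_univ_succ, Fin.succAbove]
  · ext i j
    fin_cases i <;> fin_cases j <;>
      simp [uni, isoForm, Matrix.mul_apply, Fin.sum_univ_four] <;> ring

/-- The affine lattice bases of covolume `c` on whose points `isoForm` takes values in `V` and
on whose nonzero vectors it is bounded below by `δ`. -/
def goodBases (V : Set ℝ) (δ c : ℝ) : Set (Mat4 ℝ) :=
  {A | IsAffine A ∧ A.det = c ∧
    (∀ n : Fin 4 → ℤ, n 3 = 1 → quadVal isoForm (A *ᵥ castVec n) ∈ V) ∧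
    ∀ n : Fin 4 → ℤ, n 3 = 0 → n ≠ 0 → δ ≤ |quadVal isoForm (A *ᵥ castVec n)|}

theorem continuous_quadVal_mulVec (S : Mat4 ℝ) (v : Fin 4 → ℝ) :
    Continuous fun A : Mat4 ℝ => quadVal S (A *ᵥ v) := by
  unfold quadVal; fun_prop

theorem isClosed_isAffine : IsClosed {A : Mat4 ℝ | IsAffine A} := by
  simp only [IsAffine, Set.ofPred_forall]
  exact isClosed_iInter fun j => isClosed_eq (by fun_prop) continuous_const

theorem isClosed_goodBases {V : Set ℝ} (hV : IsClosed V) (δ c : ℝ) :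
    IsClosed (goodBases V δ c) := by
  have h1 : IsClosed {A : Mat4 ℝ | A.det = c} := isClosed_eq (by fun_prop) continuous_const
  have h2 : IsClosed {A : Mat4 ℝ |
      ∀ n : Fin 4 → ℤ, n 3 = 1 → quadVal isoForm (A *ᵥ castVec n) ∈ V} := by
    simp only [Set.ofPred_forall]
    exact isClosed_iInter fun n => isClosed_iInter fun _ =>
      hV.preimage (continuous_quadVal_mulVec _ _)
  have h3 : IsClosed {A : Mat4 ℝ |
      ∀ n : Fin 4 → ℤ, n 3 = 0 → n ≠ 0 → δ ≤ |quadVal isoForm (A *ᵥ castVec n)|} := by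
    simp only [Set.ofPred_forall]
    exact isClosed_iInter fun n => isClosed_iInter fun _ => isClosed_iInter fun _ =>
      isClosed_le continuous_const (continuous_quadVal_mulVec _ _).abs
  exact isClosed_isAffine.inter (h1.inter (h2.inter h3))

theorem mul_mem_goodBases {V : Set ℝ} {δ c : ℝ} {h A : Mat4 ℝ} (hh : h ∈ isoGroup)
    (hA : A ∈ goodBases V δ c) {γ : Mat4 ℤ} (hγ : γ ∈ affineSL) :
    h * A * castMat γ ∈ goodBases V δ c := by
  have key (n : Fin 4 → ℤ) : quadVal isoForm ((h * A * castMat γ) *ᵥ castVec n)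
      = quadVal isoForm (A *ᵥ castVec (γ *ᵥ n)) := by
    rw [← castMat_mulVec, mul_assoc, ← Matrix.mulVec_mulVec, quadVal_mulVec, hh.2.2,
      ← Matrix.mulVec_mulVec]
  refine ⟨(hh.1.mul hA.1).mul hγ.2.castMat, ?_, fun n hn => ?_, fun n hn hn0 => ?_⟩
  · rw [Matrix.det_mul, Matrix.det_mul, hh.2.1, hA.2.1, det_castMat hγ]; ring
  · rw [key]
    exact hA.2.2.1 _ (by rw [hγ.2.mulVec_apply, hn])
  · rw [key]
    exact hA.2.2.2 _ (by rw [hγ.2.mulVec_apply, hn]) (mulVec_ne_zero_of_affineSL hγ hn0)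

theorem isCompact_bounded (C : ℝ) : IsCompact {A : Mat4 ℝ | ∀ i j, |A i j| ≤ C} := by
  have : {A : Mat4 ℝ | ∀ i j, |A i j| ≤ C}
      = Set.pi Set.univ fun _ => Set.pi Set.univ fun _ => Set.Icc (-C) C :=
    Set.ext fun A => ⟨fun hA i _ j _ => abs_le.1 (hA i j),
      fun hA i j => abs_le.2 (hA i trivial j trivial)⟩
  rw [this]
  exact isCompact_univ_pi fun _ => isCompact_univ_pi fun _ => isCompact_Icc

/-- Invariance under the positive half of the unipotent flow and under change of basis. -/
def FlowInvariant (M : Set (Mat4 ℝ)) : Prop :=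
  ∀ A ∈ M, ∀ t : ℝ, 0 ≤ t → ∀ γ ∈ affineSL, uni t * A * castMat γ ∈ M

theorem FlowInvariant.right {M : Set (Mat4 ℝ)} (hM : FlowInvariant M) {A : Mat4 ℝ} (hA : A ∈ M)
    {γ : Mat4 ℤ} (hγ : γ ∈ affineSL) : A * castMat γ ∈ M := by
  have := hM A hA 0 le_rfl γ hγ
  rwa [uni_zero, one_mul] at this

theorem exists_minimal_flowInvariant {B K : Set (Mat4 ℝ)} (hB : IsClosed B) (hne : B.Nonempty)
    (hinv : FlowInvariant B) (hK : IsCompact K)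
    (hBK : ∀ A ∈ B, ∃ γ ∈ affineSL, A * castMat γ ∈ K) :
    ∃ M ⊆ B, IsClosed M ∧ M.Nonempty ∧ FlowInvariant M ∧
      ∀ M' ⊆ M, IsClosed M' → M'.Nonempty → FlowInvariant M' → M' = M := by
  obtain ⟨M, hMB, hM⟩ := zorn_superset_nonempty
    {M : Set (Mat4 ℝ) | M ⊆ B ∧ IsClosed M ∧ M.Nonempty ∧ FlowInvariant M} (fun c hc hchain hcne => by
      refine ⟨⋂₀ c, ⟨?_, isClosed_sInter fun s hs => (hc hs).2.1, ?_, ?_⟩,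
        fun s hs => Set.sInter_subset_of_mem hs⟩
      · obtain ⟨s, hs⟩ := hcne
        exact (Set.sInter_subset_of_mem hs).trans (hc hs).1
      · have : Nonempty c := hcne.to_subtype
        obtain ⟨A, hA⟩ := IsCompact.nonempty_iInter_of_directed_nonempty_isCompact_isClosed
          (fun s : c => (s : Set (Mat4 ℝ)) ∩ K) (by
            intro s t
            rcases hchain.total s.2 t.2 with h | h
            · exact ⟨s, subset_rfl, Set.inter_subset_inter_left _ h⟩
            · exact ⟨t, Set.inter_subset_inter_left _ h, subset_rfl⟩)
          (fun s => by
            obtain ⟨A, hA⟩ := (hc s.2).2.2.1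
            obtain ⟨γ, hγ, hAγ⟩ := hBK A ((hc s.2).1 hA)
            exact ⟨_, (hc s.2).2.2.2.right hA hγ, hAγ⟩)
          (fun s => hK.inter_left (hc s.2).2.1)
          (fun s => (hc s.2).2.1.inter hK.isClosed)
        exact ⟨A, fun s hs => (Set.mem_iInter.1 hA ⟨s, hs⟩).1⟩
      · exact fun A hA t ht γ hγ s hs => (hc hs).2.2.2 A (hA s hs) t ht γ hγ)
    B ⟨subset_rfl, hB, hne, hinv⟩
  refine ⟨M, hMB, hM.prop.2.1, hM.prop.2.2.1, hM.prop.2.2.2, fun M' h1 h2 h3 h4 => ?_⟩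
  exact h1.antisymm (hM.le_of_le ⟨h1.trans hM.prop.1, h2, h3, h4⟩ h1)

/-- Points of a minimal invariant set are recurrent. -/
theorem mem_closure_of_minimal {M : Set (Mat4 ℝ)} (hM : IsClosed M) (hinv : FlowInvariant M)
    (hmin : ∀ M' ⊆ M, IsClosed M' → M'.Nonempty → FlowInvariant M' → M' = M) {y : Mat4 ℝ}
    (hy : y ∈ M) :
    y ∈ closure {A | ∃ t : ℝ, 1 ≤ t ∧ ∃ γ ∈ affineSL, A = uni t * y * castMat γ} := by
  set W := {A | ∃ t : ℝ, 1 ≤ t ∧ ∃ γ ∈ affineSL, A = uni t * y * castMat γ} with hW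
  have hWM : W ⊆ M := by
    rintro _ ⟨t, ht, γ, hγ, rfl⟩
    exact hinv y hy t (by linarith) γ hγ
  rw [hmin (closure W) (closure_minimal hWM hM) isClosed_closure ?_ ?_]
  · exact hy
  · exact ⟨_, subset_closure ⟨1, le_rfl, 1, one_mem_affineSL, rfl⟩⟩
  · intro A hA t ht γ hγ
    refine map_mem_closure (f := fun A : Mat4 ℝ => uni t * A * castMat γ) (by fun_prop) hA ?_
    rintro _ ⟨s, hs, η, hη, rfl⟩
    refine ⟨t + s, by linarith, η * γ, mul_mem_affineSL hη hγ, ?_⟩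
    rw [uni_add, map_mul]; simp only [mul_assoc]

/-- The matrix of the form `isoForm` in the basis `A`. -/
def isoGram (A : Mat4 ℝ) : Mat4 ℝ := Aᵀ * isoForm * A

theorem continuous_isoGram : Continuous isoGram := by unfold isoGram; fun_prop

theorem isoGram_mul (A B : Mat4 ℝ) : isoGram (A * B) = Bᵀ * isoGram A * B := by
  simp only [isoGram, Matrix.transpose_mul, mul_assoc]

theorem isoGram_isoGroup_mul {h : Mat4 ℝ} (hh : h ∈ isoGroup) (A : Mat4 ℝ) :
    isoGram (h * A) = isoGram A := by
  rw [isoGram_mul, isoGram, hh.2.2, isoGram]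

/-- The good bases whose Gram matrix is not isolated among Gram matrices of good bases. -/
def accBases (V : Set ℝ) (δ c : ℝ) : Set (Mat4 ℝ) :=
  {A | A ∈ goodBases V δ c ∧ AccPt (isoGram A) (𝓟 (isoGram '' goodBases V δ c))}

theorem isClosed_accBases {V : Set ℝ} (hV : IsClosed V) (δ c : ℝ) :
    IsClosed (accBases V δ c) :=
  (isClosed_goodBases hV δ c).inter ((isClosed_derivedSet _).preimage continuous_isoGram)

theorem flowInvariant_accBases (V : Set ℝ) (δ c : ℝ) : FlowInvariant (accBases V δ c) := by
  rintro A ⟨hA, hacc⟩ t - γ hγ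
  refine ⟨mul_mem_goodBases (uni_mem_isoGroup t) hA hγ, ?_⟩
  obtain ⟨η, -, h1, -⟩ := exists_inv_affineSL hγ
  have h1' : castMat γ * castMat η = 1 := by rw [← map_mul, h1, map_one]
  have h2' : (castMat η)ᵀ * (castMat γ)ᵀ = 1 := by
    rw [← Matrix.transpose_mul, h1', Matrix.transpose_one]
  have := hacc.map (f := fun X : Mat4 ℝ => (castMat γ)ᵀ * X * castMat γ)
    (by fun_prop) (fun X Y hXY => by
      have := congrArg (fun Z => (castMat η)ᵀ * Z * castMat η) hXY
      dsimp only at this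
      simp only [mul_assoc, h1', mul_one] at this
      simpa only [← mul_assoc, h2', one_mul] using this)
  rw [isoGram_mul, isoGram_isoGroup_mul (uni_mem_isoGroup t)]
  refine this.mono ?_
  rw [Filter.map_principal, Filter.principal_mono]
  rintro _ ⟨_, ⟨D, hD, rfl⟩, rfl⟩
  refine ⟨D * castMat γ, ?_, isoGram_mul _ _⟩
  have := mul_mem_goodBases (uni_mem_isoGroup 0) hD hγ
  rwa [uni_zero, one_mul] at this

theorem exists_isoGroup_abs_mulVec_le {v : Fin 4 → ℝ} (h0 : v 0 ≠ 0) (h2 : v 2 ≠ 0)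
    (h1 : v 1 = 0) (h3 : v 3 = 0) :
    ∃ h ∈ isoGroup, ∀ i, |(h *ᵥ v) i| ≤ √|v 0 * v 2| := by
  set l := √|v 2 / v 0| with hl
  have hl0 : 0 < l := Real.sqrt_pos.2 (abs_pos.2 (div_ne_zero h2 h0))
  refine ⟨!![l, 0, 0, 0; 0, 1, 0, 0; 0, 0, l⁻¹, 0; 0, 0, 0, 1], ⟨fun j => ?_, ?_, ?_⟩,
    fun i => ?_⟩
  · fin_cases j <;> simp [Matrix.one_apply]
  · simp [Matrix.det_succ_row_zero, Fin.sum_univ_succ, Fin.succAbove, hl0.ne']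
  · ext i j
    fin_cases i <;> fin_cases j <;>
      simp [isoForm, Matrix.mul_apply, Fin.sum_univ_four, hl0.ne']
  · have e0 : |l * v 0| = √|v 0 * v 2| := by
      refine (Real.sqrt_eq_iff_mul_self_eq (abs_nonneg _) (abs_nonneg _)).2 ?_ |>.symm
      rw [abs_mul_abs_self, show l * v 0 * (l * v 0) = l ^ 2 * v 0 ^ 2 by ring, hl, Real.sq_sqrt (abs_nonneg _),
        abs_mul, abs_div, ← sq_abs (v 0)]
      have := abs_pos.2 h0
      field_simp
    have e2 : |l⁻¹ * v 2| = √|v 0 * v 2| := by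
      rw [← e0, abs_mul, abs_mul, abs_inv, inv_mul_eq_iff_eq_mul₀ (abs_pos.2 hl0.ne').ne',
        abs_of_pos hl0, ← mul_assoc, ← sq, hl, Real.sq_sqrt (abs_nonneg _), ← abs_mul]
      congr 1; field_simp
    fin_cases i
    · simpa [Matrix.mulVec, dotProduct, Fin.sum_univ_four] using e0.le
    · simp [Matrix.mulVec, dotProduct, Fin.sum_univ_four, h1, Real.sqrt_nonneg, -abs_mul]
    · simpa [Matrix.mulVec, dotProduct, Fin.sum_univ_four] using e2.le
    · simp [Matrix.mulVec, dotProduct, Fin.sum_univ_four, h3, -abs_mul]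

theorem accBases_nonempty {V : Set ℝ} (hV : IsClosed V) {δ c C : ℝ} (hc : c ≠ 0) {A₀ : Mat4 ℝ}
    (hA₀ : A₀ ∈ goodBases V δ c)
    (hC : ∀ A ∈ goodBases V δ c, ∃ γ ∈ affineSL, ∀ i j, |(A * castMat γ) i j| ≤ C)
    {I : Set (Fin 4 → ℤ)} {m : ℝ} (hI1 : ∀ n ∈ I, (A₀ *ᵥ castVec n) 1 = 0)
    (hI3 : ∀ n ∈ I, (A₀ *ᵥ castVec n) 3 = 0)
    (hI0 : ∀ n ∈ I, quadVal isoForm (A₀ *ᵥ castVec n) ≠ 0)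
    (hIm : ∀ n ∈ I, |quadVal isoForm (A₀ *ᵥ castVec n)| ≤ m)
    (hinf : ((fun n => quadVal isoForm (A₀ *ᵥ castVec n)) '' I).Infinite) :
    (accBases V δ c).Nonempty := by
  set K := goodBases V δ c ∩ {A : Mat4 ℝ | ∀ i j, |A i j| ≤ C} with hKdef
  have hK : IsCompact K := (isCompact_bounded C).inter_left (isClosed_goodBases hV δ c)
  by_cases hfin : (isoGram '' K).Finite
  · exfalso
    obtain ⟨D, hD⟩ := (hK.prod (isCompact_closedBall (0 : Fin 4 → ℝ) √m)).exists_bound_of_continuousOn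
      (f := fun p => p.1.adjugate *ᵥ p.2) (by fun_prop)
    set N : ℤ := ⌈D / |c|⌉
    refine hinf (Set.Finite.subset (Set.Finite.image2 (fun S n => quadVal S (castVec n)) hfin
      (Set.finite_Icc (fun _ : Fin 4 => -N) fun _ => N)) ?_)
    rintro _ ⟨n, hn, rfl⟩
    have hv := hI0 n hn
    rw [quadVal_isoForm, hI1 n hn] at hv
    obtain ⟨h, hh, hhn⟩ := exists_isoGroup_abs_mulVec_le (v := A₀ *ᵥ castVec n)
      (fun h => hv (by rw [h]; ring)) (fun h => hv (by rw [h]; ring)) (hI1 n hn) (hI3 n hn)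
    have hgood : h * A₀ ∈ goodBases V δ c := by
      have := mul_mem_goodBases hh hA₀ one_mem_affineSL
      rwa [map_one, mul_one] at this
    obtain ⟨γ, hγ, hγC⟩ := hC _ hgood
    obtain ⟨η, hη, h1, -⟩ := exists_inv_affineSL hγ
    have hA := mul_mem_goodBases hh hA₀ hγ
    set A := h * A₀ * castMat γ with hAdef
    have hw : A *ᵥ castVec (η *ᵥ n) = h *ᵥ A₀ *ᵥ castVec n := by
      rw [hAdef, ← Matrix.mulVec_mulVec, castMat_mulVec, Matrix.mulVec_mulVec (N := η), h1,
        Matrix.one_mulVec, ← Matrix.mulVec_mulVec]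
    refine ⟨isoGram A, ⟨A, ⟨hA, hγC⟩, rfl⟩, η *ᵥ n, ?_, ?_⟩
    · have hle : √|(A₀ *ᵥ castVec n) 0 * (A₀ *ᵥ castVec n) 2| ≤ √m := by
        refine Real.sqrt_le_sqrt ?_
        have := hIm n hn
        rw [quadVal_isoForm, hI1 n hn, mul_assoc, zero_pow two_ne_zero, sub_zero, abs_mul,
          abs_two] at this
        nlinarith [abs_nonneg ((A₀ *ᵥ castVec n) 0 * (A₀ *ᵥ castVec n) 2)]
      have := hD (A, h *ᵥ A₀ *ᵥ castVec n) ⟨⟨hA, hγC⟩, by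
        rw [mem_closedBall_zero_iff, pi_norm_le_iff_of_nonneg (Real.sqrt_nonneg _)]
        exact fun i => (hhn i).trans hle⟩
      dsimp only at this
      rw [← hw, Matrix.mulVec_mulVec, Matrix.adjugate_mul, hA.2.1, Matrix.smul_mulVec,
        Matrix.one_mulVec, norm_smul, Real.norm_eq_abs, mul_comm, ← le_div_iff₀ (abs_pos.2 hc)] at this
      have hi (i : Fin 4) : |(η *ᵥ n) i| ≤ N := by
        have h2 := ((norm_le_pi_norm _ i).trans this).trans (Int.le_ceil _)
        rw [castVec, Real.norm_eq_abs] at h2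
        exact_mod_cast h2
      exact ⟨fun i => (abs_le.1 (hi i)).1, fun i => (abs_le.1 (hi i)).2⟩
    · dsimp only
      rw [isoGram, ← quadVal_mulVec, hw, quadVal_mulVec _ h, hh.2.2]
  · obtain ⟨x, ⟨A, hA, rfl⟩, hx⟩ :=
      Set.Infinite.exists_accPt_of_subset_isCompact hfin (hK.image continuous_isoGram) subset_rfl
    exact ⟨A, hA.1, hx.mono (Filter.principal_mono.2 (Set.image_mono Set.inter_subset_left))⟩

theorem infinite_bounded_values {a b : ℝ} (ha : 0 < a) (hb : b < 0) (hab : Irrational (a / b)) :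
    ∃ m : ℝ, {t : ℝ | ∃ p q : ℤ, a * p ^ 2 + b * q ^ 2 = t ∧ t ≠ 0 ∧ |t| ≤ m}.Infinite := by
  obtain ⟨β, hβ, rfl⟩ : ∃ β, 0 < β ∧ b = -β := ⟨-b, by linarith, by ring⟩
  set ξ := √(a / β) with hξ
  have hξ2 : ξ ^ 2 = a / β := Real.sq_sqrt (by positivity)
  have hξ0 : 0 ≤ ξ := Real.sqrt_nonneg _
  have haβ : Irrational (a / β) := by
    have := hab.neg
    rwa [div_neg, neg_neg] at this
  have hirr : Irrational ξ := fun ⟨r, hr⟩ => haβ ⟨r ^ 2, by rw [← hξ2, ← hr]; push_cast; rfl⟩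
  have hsep (p q p' q' : ℤ) (h : a * p ^ 2 + -β * q ^ 2 = a * p' ^ 2 + -β * q' ^ 2) :
      p ^ 2 = p' ^ 2 ∧ q ^ 2 = q' ^ 2 := by
    have h1 : p ^ 2 = p' ^ 2 := by
      by_contra hne
      have hne' : ((p : ℝ) ^ 2 - p' ^ 2) ≠ 0 := fun h0 => hne (by
        have : (p : ℝ) ^ 2 = p' ^ 2 := by linarith
        exact_mod_cast this)
      refine haβ ⟨(q ^ 2 - q' ^ 2) / (p ^ 2 - p' ^ 2), ?_⟩
      push_cast
      rw [div_eq_div_iff hne' hβ.ne']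
      linarith
    refine ⟨h1, ?_⟩
    have h1' : (p : ℝ) ^ 2 = p' ^ 2 := by exact_mod_cast h1
    rw [h1'] at h
    have : (q : ℝ) ^ 2 = q' ^ 2 := mul_left_cancel₀ (neg_ne_zero.2 hβ.ne') (by linarith)
    exact_mod_cast this
  refine ⟨β * (2 * ξ + 1), fun hfin => ?_⟩
  refine Real.infinite_rat_abs_sub_lt_one_div_den_sq_of_irrational hirr
    (Set.Finite.subset (hfin.preimage' (f := fun r : ℚ => a * (r.den : ℤ) ^ 2 + -β * r.num ^ 2)
      fun t _ => ?_) fun r hr => ⟨r.den, r.num, by push_cast; rfl, ?_, ?_⟩)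
  · by_cases hex : ∃ r : ℚ, a * (r.den : ℤ) ^ 2 + -β * r.num ^ 2 = t
    · obtain ⟨r, rfl⟩ := hex
      refine Set.Finite.subset (Set.toFinite {r, -r}) fun r' hr' => ?_
      obtain ⟨h1, h2⟩ := hsep _ _ _ _ (Set.mem_singleton_iff.1 hr')
      have h1' : r'.den = r.den := by
        have := sq_eq_sq₀ (by positivity) (by positivity) |>.1 h1
        exact_mod_cast this
      rcases sq_eq_sq_iff_eq_or_eq_neg.1 h2 with h | h
      · exact Or.inl (Rat.ext h h1')
      · exact Or.inr (Rat.ext (by simpa using h) (by simpa using h1'))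
    · exact Set.Finite.subset Set.finite_empty fun r hr => hex ⟨r, hr⟩
  · intro h0
    have := (hsep r.den r.num 0 0 (by push_cast at h0 ⊢; linarith)).1
    simp at this
  · have hd : (1 : ℝ) ≤ r.den := by exact_mod_cast r.den_pos
    have hr' : |ξ - r| < 1 / (r.den : ℝ) ^ 2 := hr
    have hrd : (r : ℝ) * r.den = r.num := by exact_mod_cast Rat.mul_den_eq_num r
    have hle1 : 1 / (r.den : ℝ) ^ 2 ≤ 1 := by
      rw [div_le_one (by positivity)]; nlinarith
    have e : a * ((r.den : ℤ) : ℝ) ^ 2 + -β * r.num ^ 2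
        = β * (r.den ^ 2 * ((ξ - r) * (2 * ξ - (ξ - r)))) := by
      have ha' : a = β * ξ ^ 2 := by rw [hξ2]; field_simp
      rw [← hrd, ha']; push_cast; ring
    dsimp only
    rw [e, abs_mul, abs_of_pos hβ, abs_mul, abs_mul, abs_of_nonneg (sq_nonneg (r.den : ℝ))]
    refine mul_le_mul_of_nonneg_left ?_ hβ.le
    have h2 : |2 * ξ - (ξ - r)| ≤ 2 * ξ + 1 := by
      have := abs_sub (2 * ξ) (ξ - r)
      rw [abs_of_nonneg (by positivity : 0 ≤ 2 * ξ)] at this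
      linarith
    have h3 : (r.den : ℝ) ^ 2 * |ξ - r| ≤ 1 := by
      rw [lt_div_iff₀ (by positivity)] at hr'
      linarith
    calc _ = ((r.den : ℝ) ^ 2 * |ξ - r|) * |2 * ξ - (ξ - r)| := by ring
      _ ≤ 1 * (2 * ξ + 1) := by gcongr
      _ = _ := one_mul _

theorem exists_basis_ternary {d : Fin 3 → ℝ} (hd0 : 0 < d 0) (hd1 : d 1 < 0) (hd2 : d 2 < 0)
    (s : Fin 3 → ℝ) : ∃ A : Mat4 ℝ, IsAffine A ∧ A.det ≠ 0 ∧
      (∀ n : Fin 4 → ℤ, quadVal isoForm (A *ᵥ castVec n)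
        = ∑ i : Fin 3, d i * (n i.castSucc + n 3 * s i) ^ 2) ∧
      ∀ n : Fin 4 → ℤ, n 2 = 0 → n 3 = 0 → (A *ᵥ castVec n) 1 = 0 := by
  set x := √(d 0 / 2) with hx
  set y := √(-d 1 / 2) with hy
  set z := √(-d 2) with hz
  have hx2 : x ^ 2 = d 0 / 2 := Real.sq_sqrt (by linarith)
  have hy2 : y ^ 2 = -d 1 / 2 := Real.sq_sqrt (by linarith)
  have hz2 : z ^ 2 = -d 2 := Real.sq_sqrt (by linarith)
  have hx0 : 0 < x := Real.sqrt_pos.2 (by linarith)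
  have hy0 : 0 < y := Real.sqrt_pos.2 (by linarith)
  have hz0 : 0 < z := Real.sqrt_pos.2 (by linarith)
  refine ⟨affineMat !![x, y, 0; 0, 0, z; x, -y, 0]
    ![x * s 0 + y * s 1, z * s 2, x * s 0 - y * s 1], isAffine_affineMat _ _, ?_, fun n => ?_,
    fun n h2 h3 => ?_⟩
  · rw [det_affineMat, Matrix.det_fin_three]
    simp
    have : 0 < x * y * z := by positivity
    intro h; nlinarith
  · rw [quadVal_isoForm]
    simp [affineMat, Matrix.mulVec, dotProduct, Fin.sum_univ_succ, castVec]
    rw [show d 0 = 2 * x ^ 2 by linarith, show d 1 = -2 * y ^ 2 by linarith,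
      show d 2 = -z ^ 2 by linarith]
    ring
  · simp [affineMat, Matrix.mulVec, dotProduct, Fin.sum_univ_succ, castVec]
    simp [h2, h3]

/-- The coefficients of `t` in `(uni (-t))ᵀ * S * uni (-t)`, up to sign. -/
noncomputable def conjCoeff (i : Fin 4) (S : Mat4 ℝ) : Mat4 ℝ :=
  ![nilGenᵀ * S + S * nilGen,
    nilGenᵀ * S * nilGen + (1 / 2 : ℝ) • ((nilGen * nilGen)ᵀ * S + S * (nilGen * nilGen)),
    (1 / 2 : ℝ) • ((nilGen * nilGen)ᵀ * S * nilGen + nilGenᵀ * S * (nilGen * nilGen)),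
    (1 / 4 : ℝ) • ((nilGen * nilGen)ᵀ * S * (nilGen * nilGen))] i

theorem conj_uni_neg (t : ℝ) (S : Mat4 ℝ) :
    (uni (-t))ᵀ * S * uni (-t) = S + ∑ i : Fin 4, (-t) ^ ((i : ℕ) + 1) • conjCoeff i S := by
  rw [uni_eq]
  simp only [Fin.sum_univ_four, conjCoeff]
  simp [Matrix.transpose_add, Matrix.transpose_smul, Matrix.add_mul, Matrix.mul_add, mul_assoc,
    smul_smul, smul_add]
  module

theorem continuous_conjCoeff (i : Fin 4) : Continuous (conjCoeff i) := by
  unfold conjCoeff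
  fin_cases i <;> simp <;> fun_prop

theorem conjCoeff_smul (i : Fin 4) (a : ℝ) (S : Mat4 ℝ) :
    conjCoeff i (a • S) = a • conjCoeff i S := by
  fin_cases i <;> simp [conjCoeff, smul_add, smul_smul, mul_comm]

theorem conjCoeff_zero_right (i : Fin 4) : conjCoeff i 0 = 0 := by
  simpa using conjCoeff_smul i 0 0

theorem transpose_conjCoeff (i : Fin 4) {S : Mat4 ℝ} (hS : Sᵀ = S) :
    (conjCoeff i S)ᵀ = conjCoeff i S := by
  fin_cases i <;> simp [conjCoeff, hS, mul_assoc, add_comm]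

theorem conjCoeff_zero_conjCoeff (S : Mat4 ℝ) :
    conjCoeff 0 (conjCoeff 0 S) = (2 : ℝ) • conjCoeff 1 S ∧
    conjCoeff 0 (conjCoeff 1 S) = (3 : ℝ) • conjCoeff 2 S ∧
    conjCoeff 0 (conjCoeff 2 S) = (4 : ℝ) • conjCoeff 3 S ∧
    conjCoeff 0 (conjCoeff 3 S) = 0 := by
  have h1 : nilGen * (nilGen * nilGen) = 0 := by rw [← mul_assoc, nilGen_cube]
  have h2 (X : Mat4 ℝ) : nilGenᵀ * (nilGenᵀ * (nilGenᵀ * X)) = 0 := by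
    rw [← mul_assoc, ← mul_assoc, ← Matrix.transpose_mul, ← Matrix.transpose_mul, h1]
    simp
  refine ⟨?_, ?_, ?_, ?_⟩ <;>
    simp [conjCoeff, Matrix.mul_add, Matrix.add_mul, mul_assoc, smul_add, smul_smul, h1, h2] <;>
    module

theorem exists_normalizing_time {S : Mat4 ℝ} (hS : conjCoeff 0 S ≠ 0) :
    ∃ t : ℝ, 0 ≤ t ∧ ∑ i : Fin 4, t ^ ((i : ℕ) + 1) * ‖conjCoeff i S‖ = 1 := by
  have h0 : 0 < ‖conjCoeff 0 S‖ := norm_pos_iff.2 hS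
  obtain ⟨t, ht, h⟩ := intermediate_value_Icc (inv_nonneg.2 h0.le)
    (f := fun t : ℝ => ∑ i : Fin 4, t ^ ((i : ℕ) + 1) * ‖conjCoeff i S‖)
    (by fun_prop) (show (1 : ℝ) ∈ _ from ⟨by simp, by
      refine le_trans ?_ (Finset.single_le_sum (fun i _ => by positivity) (Finset.mem_univ 0))
      simp [h0.ne']⟩)
  exact ⟨t, ht.1, h⟩

theorem norm_smul_conjCoeff_le {S : Mat4 ℝ} {t : ℝ} (ht : 0 ≤ t)
    (h : ∑ i : Fin 4, t ^ ((i : ℕ) + 1) * ‖conjCoeff i S‖ = 1) (i : Fin 4) :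
    ‖t • conjCoeff 0 (t ^ ((i : ℕ) + 1) • conjCoeff i S)‖ ≤ 4 := by
  have hle (j : Fin 4) : t ^ ((j : ℕ) + 1) * ‖conjCoeff j S‖ ≤ 1 :=
    h ▸ Finset.single_le_sum (f := fun i : Fin 4 => t ^ ((i : ℕ) + 1) * ‖conjCoeff i S‖)
      (fun i _ => by positivity) (Finset.mem_univ j)
  have h1 := hle 1
  have h2 := hle 2
  have h3 := hle 3
  obtain ⟨e0, e1, e2, e3⟩ := conjCoeff_zero_conjCoeff S
  rw [conjCoeff_smul, norm_smul, norm_smul, norm_pow, Real.norm_of_nonneg ht]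
  simp at h1 h2 h3
  fin_cases i <;> simp only [Fin.zero_eta, Fin.mk_one, Fin.reduceFinMk, e0, e1, e2, e3, norm_smul] <;>
    simp <;> nlinarith

theorem entries_of_conjCoeff_eq_zero {S : Mat4 ℝ} (hS : Sᵀ = S) (h : conjCoeff 0 S = 0) :
    S 0 0 = 0 ∧ S 0 1 = 0 ∧ S 0 3 = 0 ∧ S 1 2 = 0 ∧ S 1 3 = 0 ∧ S 1 1 = - S 0 2 := by
  have e (i j : Fin 4) : S j i = S i j := congrFun (congrFun hS i) j
  have k (i j : Fin 4) : conjCoeff 0 S i j = 0 := by rw [h]; rfl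
  have k01 := k 0 1
  have k11 := k 1 1
  have k12 := k 1 2
  have k13 := k 1 3
  have k23 := k 2 3
  have k22 := k 2 2
  have e1 := e 0 1
  have e2 := e 1 2
  have e3 := e 0 2
  simp [conjCoeff, nilGen, Matrix.mul_apply, Fin.sum_univ_four] at k01 k11 k12 k13 k23 k22
  refine ⟨by linarith, by linarith, by linarith, by linarith, by linarith, by linarith⟩

/-- The determinant of the linear part. -/
def linDet (X : Mat4 ℝ) : ℝ := (X.submatrix Fin.castSucc Fin.castSucc).det

theorem continuous_linDet : Continuous linDet := by unfold linDet; fun_prop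

theorem det_isoGram (A : Mat4 ℝ) : (isoGram A).det = 0 := by
  have : isoForm.det = 0 := Matrix.det_eq_zero_of_row_eq_zero 3 fun j => by
    fin_cases j <;> simp [isoForm]
  rw [isoGram, Matrix.det_mul, Matrix.det_mul, this]; ring

theorem linDet_isoGram {A : Mat4 ℝ} (hA : IsAffine A) (h1 : A.det = 1) :
    linDet (isoGram A) = 1 := by
  obtain ⟨B, ξ, rfl⟩ : ∃ B ξ, A = affineMat B ξ := ⟨_, _, hA.eq_affineMat⟩
  rw [det_affineMat] at h1
  have : (isoGram (affineMat B ξ)).submatrix Fin.castSucc Fin.castSucc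
      = Bᵀ * !![0, 0, 1; 0, -1, 0; 1, 0, 0] * B := by
    ext i j
    fin_cases i <;> fin_cases j <;>
      simp [isoGram, isoForm, affineMat, Matrix.mul_apply, Fin.sum_univ_succ, Fin.castSucc]
  rw [linDet, this, Matrix.det_mul, Matrix.det_mul, Matrix.det_transpose, h1, Matrix.det_fin_three]
  simp

theorem isoGram_mul_uni_neg {g : Mat4 ℝ} (τ t : ℝ) :
    isoGram (g * uni (-(τ * t))) = isoForm + ((isoGram g - isoForm) +
      ∑ i : Fin 4, (-τ) ^ ((i : ℕ) + 1) • t ^ ((i : ℕ) + 1) • conjCoeff i (isoGram g - isoForm)) := by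
  have h1 := conj_uni_neg (τ * t) (isoGram g - isoForm)
  rw [Matrix.mul_sub, Matrix.sub_mul, (uni_mem_isoGroup _).2.2, ← isoGram_mul,
    sub_eq_iff_eq_add'] at h1
  rw [h1]
  simp only [smul_smul, ← mul_pow, neg_mul]

theorem exists_limit_forms {V : Set ℝ} {δ c : ℝ} (hV : IsClosed V) {M K : Set (Mat4 ℝ)}
    (hM : IsClosed M) (hinv : FlowInvariant M) (hK : IsCompact K)
    (hMK : ∀ A ∈ M, ∃ γ ∈ affineSL, A * castMat γ ∈ K)
    (H : ∀ ε > 0, ∃ y ∈ M, ∃ g : Mat4 ℝ, IsAffine g ∧ g.det = 1 ∧ g * y ∈ goodBases V δ c ∧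
      ‖isoGram g - isoForm‖ < ε ∧ conjCoeff 0 (isoGram g - isoForm) ≠ 0) :
    ∃ r : Fin 4 → Mat4 ℝ, r ≠ 0 ∧ (∀ i, (r i)ᵀ = r i ∧ conjCoeff 0 (r i) = 0) ∧
      ∀ τ : ℝ, 0 ≤ τ →
        (isoForm + ∑ i : Fin 4, (-τ) ^ ((i : ℕ) + 1) • r i).det = 0 ∧
        linDet (isoForm + ∑ i : Fin 4, (-τ) ^ ((i : ℕ) + 1) • r i) = 1 ∧
        ∃ m ∈ M, ∀ n : Fin 4 → ℤ, n 3 = 1 →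
          quadVal (isoForm + ∑ i : Fin 4, (-τ) ^ ((i : ℕ) + 1) • r i) (m *ᵥ castVec n) ∈ V := by
  have : FirstCountableTopology (Mat4 ℝ) :=
    inferInstanceAs (FirstCountableTopology (Fin 4 → Fin 4 → ℝ))
  choose y hy g hg hg1 hgy hgε hgL using fun k : ℕ => H (1 / ((k : ℝ) + 1)) (by positivity)
  set S : ℕ → Mat4 ℝ := fun k => isoGram (g k) - isoForm with hS
  have hS0 : Tendsto S atTop (𝓝 0) :=
    squeeze_zero_norm (fun k => (hgε k).le) tendsto_one_div_add_atTop_nhds_zero_nat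
  choose t ht0 ht using fun k => exists_normalizing_time (hgL k)
  have ht_top : Tendsto t atTop atTop := by
    refine tendsto_atTop.2 fun T => ?_
    have h1 : Tendsto (fun k => ∑ i : Fin 4, |T| ^ ((i : ℕ) + 1) * ‖conjCoeff i (S k)‖) atTop
        (𝓝 (∑ i : Fin 4, |T| ^ ((i : ℕ) + 1) * ‖conjCoeff i 0‖)) :=
      tendsto_finsetSum _ fun i _ => tendsto_const_nhds.mul
        (((continuous_conjCoeff i).tendsto 0).comp hS0).norm
    simp only [conjCoeff_zero_right, norm_zero, mul_zero, Finset.sum_const_zero] at h1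
    filter_upwards [h1.eventually_lt_const one_pos] with k hk
    by_contra! hlt
    refine absurd (ht k) (ne_of_lt (lt_of_le_of_lt ?_ hk))
    gcongr
    exacts [ht0 k, hlt.le.trans (le_abs_self T)]
  set r : ℕ → Fin 4 → Mat4 ℝ := fun k i => t k ^ ((i : ℕ) + 1) • conjCoeff i (S k) with hr
  have hrnorm (k : ℕ) : ∑ i, ‖r k i‖ = 1 := by
    rw [← ht k]
    refine Finset.sum_congr rfl fun i _ => ?_
    rw [hr]; dsimp only
    rw [norm_smul, norm_pow, Real.norm_of_nonneg (ht0 k)]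
  obtain ⟨ρ, -, φ, hφ, hρ⟩ := (isCompact_univ_pi fun _ : Fin 4 => isCompact_bounded 1).tendsto_subseq
    (x := r) fun k i _ a b => by
      refine (Matrix.norm_entry_le_entrywise_sup_norm (r k i)).trans ?_
      rw [← hrnorm k]
      exact Finset.single_le_sum (f := fun i => ‖r k i‖) (fun i _ => norm_nonneg _)
        (Finset.mem_univ i)
  have hρi (i : Fin 4) : Tendsto (fun k => r (φ k) i) atTop (𝓝 (ρ i)) := tendsto_pi_nhds.1 hρ i
  have hSsymm (k : ℕ) : (S k)ᵀ = S k := by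
    have : isoFormᵀ = isoForm := by
      ext i j; fin_cases i <;> fin_cases j <;> simp [isoForm]
    simp [hS, isoGram, this, mul_assoc]
  refine ⟨ρ, ?_, fun i => ⟨?_, ?_⟩, fun τ hτ => ?_⟩
  · rintro rfl
    have := tendsto_finsetSum (Finset.univ : Finset (Fin 4)) fun i _ => (hρi i).norm
    simp only [hrnorm] at this
    simpa using tendsto_nhds_unique this tendsto_const_nhds
  · refine tendsto_nhds_unique ((continuous_id.matrix_transpose.tendsto _).comp (hρi i)) ?_
    convert hρi i using 2 with k
    simp [hr, transpose_conjCoeff i (hSsymm _)]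
  · have h1 := ((continuous_conjCoeff 0).tendsto _).comp (hρi i)
    have hinvt : Tendsto (fun k => 4 * (t (φ k))⁻¹) atTop (𝓝 (4 * 0)) :=
      (tendsto_inv_atTop_zero.comp (ht_top.comp hφ.tendsto_atTop)).const_mul 4
    rw [mul_zero] at hinvt
    refine tendsto_nhds_unique h1 (squeeze_zero_norm' ?_ hinvt)
    filter_upwards [(ht_top.comp hφ.tendsto_atTop).eventually_gt_atTop 0] with k hk
    have := norm_smul_conjCoeff_le (ht0 (φ k)) (ht (φ k)) i
    rw [norm_smul, Real.norm_of_nonneg (ht0 _)] at this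
    rw [← div_eq_mul_inv]
    exact (le_div_iff₀' hk).2 this
  · set F : ℕ → Mat4 ℝ := fun k => isoForm + (S k + ∑ i : Fin 4, (-τ) ^ ((i : ℕ) + 1) • r k i)
      with hF
    have hFg (k : ℕ) : F k = isoGram (g k * uni (-(τ * t k))) := (isoGram_mul_uni_neg _ _).symm
    have hlim : Tendsto (fun k => F (φ k)) atTop
        (𝓝 (isoForm + ∑ i : Fin 4, (-τ) ^ ((i : ℕ) + 1) • ρ i)) := by
      have := tendsto_const_nhds (x := isoForm).add ((hS0.comp hφ.tendsto_atTop).add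
        (tendsto_finsetSum Finset.univ fun i _ => (hρi i).const_smul ((-τ) ^ ((i : ℕ) + 1))))
      rw [zero_add] at this
      exact this
    have haff (k : ℕ) : IsAffine (g k * uni (-(τ * t k))) := (hg k).mul (uni_mem_isoGroup _).1
    have hdet (k : ℕ) : (g k * uni (-(τ * t k))).det = 1 := by
      rw [Matrix.det_mul, hg1, (uni_mem_isoGroup _).2.1, one_mul]
    refine ⟨?_, ?_, ?_⟩
    · refine tendsto_nhds_unique ((continuous_id.matrix_det.tendsto _).comp hlim) ?_
      simp [Function.comp_def, hFg, det_isoGram]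
    · refine tendsto_nhds_unique ((continuous_linDet.tendsto _).comp hlim) ?_
      simp [Function.comp_def, hFg, linDet_isoGram (haff _) (hdet _)]
    · choose γ hγ hγK using fun k => hMK _ (by
        have := hinv (y k) (hy k) (τ * t k) (mul_nonneg hτ (ht0 k)) 1 one_mem_affineSL
        rwa [map_one, mul_one] at this : uni (τ * t k) * y k ∈ M)
      have hmM (k : ℕ) : uni (τ * t k) * y k * castMat (γ k) ∈ M :=
        hinv (y k) (hy k) _ (mul_nonneg hτ (ht0 k)) _ (hγ k)
      obtain ⟨m, -, ψ, hψ, hm⟩ := hK.tendsto_subseq fun k => hγK (φ k)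
      refine ⟨m, hM.mem_of_tendsto hm (Eventually.of_forall fun k => hmM _), fun n hn => ?_⟩
      have hc : Continuous fun p : Mat4 ℝ × Mat4 ℝ => quadVal p.1 (p.2 *ᵥ castVec n) := by
        unfold quadVal; fun_prop
      have hlim2 := (hc.tendsto _).comp ((hlim.comp hψ.tendsto_atTop).prodMk_nhds hm)
      refine hV.mem_of_tendsto hlim2 (Eventually.of_forall fun k => ?_)
      simp only [Function.comp_apply]
      set k' := φ (ψ k)
      have hgood := mul_mem_goodBases (uni_mem_isoGroup 0) (hgy k') (hγ k')
      rw [uni_zero, one_mul] at hgood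
      have := hgood.2.2.1 n hn
      have heq : g k' * uni (-(τ * t k')) * (uni (τ * t k') * y k' * castMat (γ k'))
          = g k' * y k' * castMat (γ k') := by
        rw [mul_assoc (g k'), mul_assoc (uni (τ * t k')) (y k'), ← mul_assoc (uni _) (uni _),
          ← uni_add, neg_add_cancel, uni_zero, one_mul, mul_assoc]
      rw [← heq, ← Matrix.mulVec_mulVec, quadVal_mulVec] at this
      rw [hFg]
      exact this

theorem entries_of_degenerate {X : Mat4 ℝ} (hX : Xᵀ = X) (h : conjCoeff 0 X = 0)
    (h0 : (isoForm + X).det = 0) (h1 : linDet (isoForm + X) = 1) :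
    X = !![0, 0, 0, 0; 0, 0, 0, 0; 0, 0, X 2 2, X 2 3; 0, 0, X 2 3, 0] := by
  have e (i j : Fin 4) : X j i = X i j := congrFun (congrFun hX i) j
  obtain ⟨h00, h01, h03, h12, h13, h11⟩ := entries_of_conjCoeff_eq_zero hX h
  have hXe : X = !![0, 0, X 0 2, 0; 0, -X 0 2, 0, 0; X 0 2, 0, X 2 2, X 2 3;
      0, 0, X 2 3, X 3 3] := by
    ext i j
    have := e i j
    fin_cases i <;> fin_cases j <;> simp [h00, h01, h03, h12, h13, h11] at this ⊢ <;>
      first | assumption | exact this.symm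
  generalize X 0 2 = u, X 2 2 = a, X 2 3 = b, X 3 3 = c at hXe
  subst hXe
  have h1' : linDet (isoForm + !![0, 0, u, 0; 0, -u, 0, 0; u, 0, a, b; 0, 0, b, c])
      = (1 + u) ^ 3 := by
    rw [linDet, Matrix.det_fin_three]
    simp [isoForm]; ring
  rw [h1] at h1'
  have hu : u = 0 := by nlinarith [sq_nonneg (u + 3 / 2)]
  subst hu
  have hc : c = 0 := by
    simpa [isoForm, Matrix.det_succ_row_zero, Fin.sum_univ_succ, Fin.succAbove] using h0
  subst hc
  simp

theorem tendsto_sum_pow_atTop (c : Fin 4 → ℝ) {k : Fin 4} (hk : 0 < c k)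
    (hc : ∀ i, k < i → c i = 0) :
    Tendsto (fun τ : ℝ => ∑ i : Fin 4, c i * τ ^ ((i : ℕ) + 1)) atTop atTop := by
  have step {f : ℝ → ℝ} (a : ℝ) (hf : Tendsto f atTop atTop) :
      Tendsto (fun τ => a + τ * f τ) atTop atTop :=
    tendsto_atTop_add_const_left _ _ (tendsto_id.atTop_mul_atTop₀ hf)
  have base (a : ℝ) (ha : 0 < a) : Tendsto (fun τ => 0 + τ * a) atTop atTop := by
    simpa using tendsto_id.atTop_mul_const ha
  have e : (fun τ : ℝ => ∑ i : Fin 4, c i * τ ^ ((i : ℕ) + 1))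
      = fun τ => 0 + τ * (c 0 + τ * (c 1 + τ * (c 2 + τ * c 3))) := by
    ext τ; simp [Fin.sum_univ_four]; ring
  rw [e]
  have h1 : k < 1 → c 1 = 0 := hc 1
  have h2 : k < 2 → c 2 = 0 := hc 2
  have h3 : k < 3 → c 3 = 0 := hc 3
  have base' (b a : ℝ) (ha : 0 < a) : Tendsto (fun τ => b + τ * a) atTop atTop :=
    tendsto_atTop_add_const_left _ _ (tendsto_id.atTop_mul_const ha)
  fin_cases k
  · simpa [h1, h2, h3] using base' 0 (c 0) hk
  · simpa [h2, h3] using step 0 (base' (c 0) (c 1) hk)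
  · simpa [h3] using step 0 (step (c 0) (base' (c 1) (c 2) hk))
  · exact step 0 (step (c 0) (step (c 1) (base' (c 2) (c 3) hk)))

theorem exists_sign_eventually_pos {α β : ℝ} (h : α ≠ 0 ∨ β ≠ 0) :
    ∃ σ Z : ℝ, |σ| = 1 ∧ ∀ z, Z ≤ z → 0 < σ * (α * z ^ 2 + 2 * β * z) := by
  have pos {α β : ℝ} (hα : 0 < α) : ∀ z, (2 * |β| + 1) / α ≤ z → 0 < α * z ^ 2 + 2 * β * z := by
    intro z hz
    have hz0 : 0 < z := lt_of_lt_of_le (by positivity) hz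
    rw [div_le_iff₀ hα] at hz
    have : 0 < z * (α * z + 2 * β) := mul_pos hz0 (by linarith [neg_abs_le β])
    linarith
  rcases lt_trichotomy α 0 with hα | rfl | hα
  · refine ⟨-1, (2 * |-β| + 1) / -α, by simp, fun z hz => ?_⟩
    linarith [pos (β := -β) (neg_pos.2 hα) z hz]
  · have hβ : β ≠ 0 := by simpa using h
    rcases hβ.lt_or_gt with hβ | hβ
    · refine ⟨-1, 1, by simp, fun z hz => by nlinarith⟩
    · refine ⟨1, 1, by simp, fun z hz => by nlinarith⟩
  · refine ⟨1, (2 * |β| + 1) / α, by simp, fun z hz => ?_⟩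
    linarith [pos (β := β) hα z hz]

theorem exists_sign_tendsto {α β : Fin 4 → ℝ} (h : ∃ i, α i ≠ 0 ∨ β i ≠ 0) :
    ∃ σ Z : ℝ, |σ| = 1 ∧ ∀ z, Z ≤ z → Tendsto
      (fun τ : ℝ => ∑ i : Fin 4, σ * (α i * z ^ 2 + 2 * β i * z) * τ ^ ((i : ℕ) + 1))
      atTop atTop := by
  obtain ⟨k, hk, hmax⟩ := Finset.exists_max_image (Finset.univ.filter fun i => α i ≠ 0 ∨ β i ≠ 0)
    id (by simpa [Finset.Nonempty] using h)
  obtain ⟨σ, Z, hσ, hZ⟩ := exists_sign_eventually_pos (Finset.mem_filter.1 hk).2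
  refine ⟨σ, Z, hσ, fun z hz => tendsto_sum_pow_atTop _ (hZ z hz) fun i hi => ?_⟩
  have : ¬ (α i ≠ 0 ∨ β i ≠ 0) := fun hi' =>
    absurd (hmax i (by simpa using hi')) (not_le.2 hi)
  push Not at this
  rw [this.1, this.2]; ring

theorem IsAffine.exists_int_near {A : Mat4 ℝ} (hA : IsAffine A) (hd : A.det ≠ 0) :
    ∃ D : ℝ, ∀ p : Fin 4 → ℝ, p 3 = 1 →
      ∃ n : Fin 4 → ℤ, n 3 = 1 ∧ ∀ i, |(A *ᵥ castVec n) i - p i| ≤ D := by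
  refine ⟨∑ i, ∑ j, |A i j|, fun p hp => ?_⟩
  set u := A⁻¹ *ᵥ p with hu
  have hAu : A *ᵥ u = p := by
    rw [hu, Matrix.mulVec_mulVec, Matrix.mul_nonsing_inv _ (isUnit_iff_ne_zero.2 hd),
      Matrix.one_mulVec]
  have hu3 : u 3 = 1 := by rw [← hA.mulVec_apply u, hAu, hp]
  refine ⟨fun i => ⌊u i⌋, by simp [hu3], fun i => ?_⟩
  rw [← congrFun hAu i]
  rw [← Pi.sub_apply, ← Matrix.mulVec_sub]
  rw [Matrix.mulVec, dotProduct]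
  refine (Finset.abs_sum_le_sum_abs _ _).trans ?_
  refine le_trans ?_ (Finset.single_le_sum (f := fun i => ∑ j, |A i j|)
    (fun i _ => Finset.sum_nonneg fun j _ => abs_nonneg _) (Finset.mem_univ i))
  refine Finset.sum_le_sum fun j _ => ?_
  rw [abs_mul]
  refine mul_le_of_le_one_right (abs_nonneg _) ?_
  simp only [Pi.sub_apply, castVec]
  rw [abs_le]
  constructor <;> linarith [Int.floor_le (u j), Int.lt_floor_add_one (u j)]

theorem IsAffine.exists_int_quadVal_le {A : Mat4 ℝ} (hA : IsAffine A) (hd : A.det ≠ 0) (σ Z r : ℝ)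
    (hσ : |σ| = 1) : ∃ n : Fin 4 → ℤ, n 3 = 1 ∧ Z ≤ (A *ᵥ castVec n) 2 ∧
      σ * quadVal isoForm (A *ᵥ castVec n) ≤ r := by
  obtain ⟨D, hD⟩ := hA.exists_int_near hd
  obtain ⟨n, hn, h⟩ := hD ![-σ * (|r| + D ^ 2 + D), 0, |Z| + 1 + D, 1] rfl
  refine ⟨n, hn, ?_⟩
  have h0 := h 0
  have h1 := h 1
  have h2 := h 2
  rw [quadVal_isoForm]
  generalize A *ᵥ castVec n = v at *
  simp only [Matrix.cons_val_zero, Matrix.cons_val_one, Matrix.cons_val] at h0 h1 h2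
  rw [sub_zero] at h1
  rw [abs_le] at h2
  have hσ2 : σ * σ = 1 := by rw [← abs_mul_abs_self, hσ, one_mul]
  have hx : σ * v 0 ≤ -(|r| + D ^ 2) := by
    have h3 : |σ * (v 0 - -σ * (|r| + D ^ 2 + D))| ≤ D := by rwa [abs_mul, hσ, one_mul]
    have h4 : σ * (v 0 - -σ * (|r| + D ^ 2 + D)) = σ * v 0 + σ * σ * (|r| + D ^ 2 + D) := by ring
    rw [h4, hσ2] at h3
    linarith [(abs_le.1 h3).2]
  have hy : -σ * v 1 ^ 2 ≤ D ^ 2 := by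
    have : v 1 ^ 2 ≤ D ^ 2 := sq_le_sq' (by linarith [(abs_le.1 h1).1]) (abs_le.1 h1).2
    have := neg_le_of_abs_le hσ.le
    nlinarith [sq_nonneg (v 1)]
  have hz : 1 ≤ v 2 := by linarith [abs_nonneg Z]
  refine ⟨by linarith [le_abs_self Z], ?_⟩
  have h5 : σ * v 0 * v 2 ≤ -(|r| + D ^ 2) * 1 := by
    nlinarith [abs_nonneg r, sq_nonneg D]
  have := neg_abs_le r
  nlinarith [sq_nonneg D, abs_nonneg r]

theorem mem_of_limit_forms {V : Set ℝ} (hV : IsClosed V) {M : Set (Mat4 ℝ)}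
    (hM : IsClosed M) (hinv : FlowInvariant M)
    (hmin : ∀ M' ⊆ M, IsClosed M' → M'.Nonempty → FlowInvariant M' → M' = M)
    (hMne : M.Nonempty) (hMd : ∀ m ∈ M, IsAffine m ∧ m.det ≠ 0) {ρ : Fin 4 → Mat4 ℝ} (hρ0 : ρ ≠ 0)
    (hρ : ∀ i, (ρ i)ᵀ = ρ i ∧ conjCoeff 0 (ρ i) = 0)
    (h : ∀ τ : ℝ, 0 ≤ τ →
        (isoForm + ∑ i : Fin 4, (-τ) ^ ((i : ℕ) + 1) • ρ i).det = 0 ∧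
        linDet (isoForm + ∑ i : Fin 4, (-τ) ^ ((i : ℕ) + 1) • ρ i) = 1 ∧
        ∃ m ∈ M, ∀ n : Fin 4 → ℤ, n 3 = 1 →
          quadVal (isoForm + ∑ i : Fin 4, (-τ) ^ ((i : ℕ) + 1) • ρ i) (m *ᵥ castVec n) ∈ V)
    (r : ℝ) : r ∈ V := by
  set R : ℝ → Mat4 ℝ := fun τ => ∑ i : Fin 4, (-τ) ^ ((i : ℕ) + 1) • ρ i with hR
  have hRent (τ : ℝ) (hτ : 0 ≤ τ) : R τ = !![0, 0, 0, 0; 0, 0, 0, 0; 0, 0, R τ 2 2, R τ 2 3;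
      0, 0, R τ 2 3, 0] := by
    refine entries_of_degenerate ?_ ?_ (h τ hτ).1 (h τ hτ).2.1
    · simp [hR, Matrix.transpose_sum, (hρ _).1]
    · have hadd (X Y : Mat4 ℝ) : conjCoeff 0 (X + Y) = conjCoeff 0 X + conjCoeff 0 Y := by
        simp [conjCoeff, Matrix.mul_add, Matrix.add_mul]; abel
      simp only [hR, Fin.sum_univ_four, hadd, conjCoeff_smul, (hρ _).2, smul_zero, add_zero]
  have hRij (τ : ℝ) (i j : Fin 4) : R τ i j = ∑ k : Fin 4, (-τ) ^ ((k : ℕ) + 1) * ρ k i j := by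
    simp [hR, Matrix.sum_apply]
  have hval (τ : ℝ) (hτ : 0 ≤ τ) (v : Fin 4 → ℝ) (hv : v 3 = 1) : quadVal (isoForm + R τ) v
      = quadVal isoForm v + (R τ 2 2 * v 2 ^ 2 + 2 * R τ 2 3 * v 2) := by
    rw [hRent τ hτ]
    simp [quadVal, isoForm, Matrix.mulVec, dotProduct, Fin.sum_univ_four, hv]
    ring
  have hall (τ : ℝ) (hτ : 0 ≤ τ) (m : Mat4 ℝ) (hm : m ∈ M) (n : Fin 4 → ℤ) (hn : n 3 = 1) :
      quadVal (isoForm + R τ) (m *ᵥ castVec n) ∈ V := by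
    have hset := hmin (M ∩ {m | ∀ n : Fin 4 → ℤ, n 3 = 1 →
        quadVal (isoForm + R τ) (m *ᵥ castVec n) ∈ V}) Set.inter_subset_left
      (hM.inter (by
        simp only [Set.ofPred_forall]
        exact isClosed_iInter fun n => isClosed_iInter fun _ =>
          hV.preimage (continuous_quadVal_mulVec _ _)))
      (by
        obtain ⟨m, hm, hmV⟩ := (h τ hτ).2.2
        exact ⟨m, hm, hmV⟩)
      (by
        rintro A ⟨hA, hAV⟩ t ht γ hγ
        refine ⟨hinv A hA t ht γ hγ, fun n hn => ?_⟩
        have hn' : (γ *ᵥ n) 3 = 1 := by rw [hγ.2.mulVec_apply, hn]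
        have := hAV (γ *ᵥ n) hn'
        have h3 : (A *ᵥ castVec (γ *ᵥ n)) 3 = 1 := by
          rw [(hMd A hA).1.mulVec_apply, castVec, hn']; simp
        rw [hval τ hτ _ h3] at this
        rw [mul_assoc, ← Matrix.mulVec_mulVec, ← Matrix.mulVec_mulVec, castMat_mulVec, hval τ hτ,
          quadVal_mulVec, (uni_mem_isoGroup t).2.2]
        · convert this using 2
          generalize A *ᵥ castVec (γ *ᵥ n) = w
          simp [uni, Matrix.mulVec, dotProduct, Fin.sum_univ_four]
        · rw [(uni_mem_isoGroup t).1.mulVec_apply, h3])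
    rw [← hset] at hm
    exact hm.2 n hn
  have hne : ∃ i : Fin 4, (-1) ^ ((i : ℕ) + 1) * ρ i 2 2 ≠ 0 ∨
      (-1) ^ ((i : ℕ) + 1) * ρ i 2 3 ≠ 0 := by
    by_contra! hcon
    have h22 (i : Fin 4) : ρ i 2 2 = 0 := by simpa using (hcon i).1
    have h23 (i : Fin 4) : ρ i 2 3 = 0 := by simpa using (hcon i).2
    have hzero (τ : ℝ) (hτ : 0 ≤ τ) : R τ = 0 := by
      rw [hRent τ hτ, hRij, hRij]
      simp only [h22, h23]
      ext i j
      fin_cases i <;> fin_cases j <;> simp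
    refine hρ0 (funext fun k => Matrix.ext fun i j => ?_)
    have hz (τ : ℝ) (hτ : 0 ≤ τ) := hRij τ i j
    simp only [Fin.sum_univ_four] at hz
    have z1 := hz 1 (by norm_num)
    have z2 := hz 2 (by norm_num)
    have z3 := hz 3 (by norm_num)
    have z4 := hz 4 (by norm_num)
    rw [hzero _ (by norm_num)] at z1 z2 z3 z4
    simp at z1 z2 z3 z4
    norm_num at z1 z2 z3 z4
    fin_cases k <;> simp <;> linarith
  obtain ⟨m, hm⟩ := hMne
  obtain ⟨σ, Z, hσ, hZ⟩ := exists_sign_tendsto hne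
  obtain ⟨n, hn, hz, hq⟩ := (hMd m hm).1.exists_int_quadVal_le (hMd m hm).2 σ Z (σ * r) hσ
  have hv := fun τ hτ => hall τ hτ m hm n hn
  have h3 : (m *ᵥ castVec n) 3 = 1 := by
    rw [(hMd m hm).1.mulVec_apply, castVec, hn]; simp
  have hlim := hZ _ hz
  set v := m *ᵥ castVec n with hvdef
  set f : ℝ → ℝ := fun τ => ∑ i : Fin 4, σ * ((-1) ^ ((i : ℕ) + 1) * ρ i 2 2 * v 2 ^ 2
    + 2 * ((-1) ^ ((i : ℕ) + 1) * ρ i 2 3) * v 2) * τ ^ ((i : ℕ) + 1) with hf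
  obtain ⟨T, hT0, hT⟩ := ((eventually_ge_atTop 0).and
    (hlim.eventually_ge_atTop (σ * r - σ * quadVal isoForm v))).exists
  obtain ⟨τ, hτ, hτr⟩ := intermediate_value_Icc hT0 (f := f) (by rw [hf]; fun_prop)
    (show σ * r - σ * quadVal isoForm v ∈ _ from ⟨by simp [hf, hq], hT⟩)
  have hvτ := hv τ hτ.1
  rw [hval τ hτ.1 v h3] at hvτ
  convert hvτ using 1
  have hσ0 : σ ≠ 0 := by
    rintro rfl; simp at hσ
  refine mul_left_cancel₀ hσ0 ?_
  have : f τ = σ * (R τ 2 2 * v 2 ^ 2 + 2 * R τ 2 3 * v 2) := by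
    rw [hRij, hRij, hf]
    simp [Fin.sum_univ_four]; ring
  linarith

theorem IsAffine.inv {A : Mat4 ℝ} (hA : IsAffine A) (hd : A.det ≠ 0) : IsAffine A⁻¹ := fun j =>
  (hA.mul_apply A⁻¹ j).symm.trans (by rw [Matrix.mul_nonsing_inv _ (isUnit_iff_ne_zero.2 hd)])

/-- A matrix close to one, which preserves both the shape of a degenerate deformation of `isoForm`
and the shape of the deformations of zero, is upper triangular. -/
theorem entries_of_preserves_shape {g : Mat4 ℝ} (hg : IsAffine g) {a b a₁ b₁ a₂ b₂ : ℝ}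
    (hab : a ≠ 0 ∨ b ≠ 0) (hg1 : 0 < g 1 1)
    (h1 : isoGram g = isoForm + !![0, 0, 0, 0; 0, 0, 0, 0; 0, 0, a₁, b₁; 0, 0, b₁, 0])
    (h2 : gᵀ * !![0, 0, 0, 0; 0, 0, 0, 0; 0, 0, a, b; 0, 0, b, 0] * g
      = !![0, 0, 0, 0; 0, 0, 0, 0; 0, 0, a₂, b₂; 0, 0, b₂, 0]) :
    g 2 0 = 0 ∧ g 2 1 = 0 ∧ g 1 0 = 0 ∧ g 1 1 = 1 ∧ g 0 0 * g 2 2 = 1 := by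
  have g0 := hg 0
  have g1 := hg 1
  have g2 := hg 2
  have g3 := hg 3
  simp at g0 g1 g2 g3
  have k (i j : Fin 4) := congrFun (congrFun h2 i) j
  have k00 := k 0 0
  have k03 := k 0 3
  have k11 := k 1 1
  have k13 := k 1 3
  have l (i j : Fin 4) := congrFun (congrFun h1 i) j
  have l00 := l 0 0
  have l11 := l 1 1
  have l02 := l 0 2
  simp [Matrix.mul_apply, Fin.sum_univ_four, g0, g1, g3] at k00 k03 k11 k13
  have z0 : g 2 0 = 0 := by
    rcases eq_or_ne a 0 with rfl | ha
    · simpa [hab.resolve_left (by simp)] using k03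
    · simpa [ha] using k00
  have z1 : g 2 1 = 0 := by
    rcases eq_or_ne a 0 with rfl | ha
    · simpa [hab.resolve_left (by simp)] using k13
    · simpa [ha] using k11
  simp [isoGram, isoForm, Matrix.mul_apply, Fin.sum_univ_four, z0, z1] at l00 l11 l02
  refine ⟨z0, z1, l00, by nlinarith, by rw [l00] at l02; linarith⟩

theorem mulVec_sq_of_unipotent {P : Mat4 ℝ} (h0 : P 0 0 = 0) (h1 : P 1 0 = 0) (h2 : P 1 1 = 0)
    (h3 : P 2 0 = 0) (h4 : P 2 1 = 0) (h5 : P 2 2 = 0) (h6 : ∀ j, P 3 j = 0) {v : Fin 4 → ℝ}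
    (hv : v 3 = 0) : (P * P) *ᵥ v = ![P 0 1 * P 1 2 * v 2, 0, 0, 0] := by
  rw [← Matrix.mulVec_mulVec]
  ext i
  fin_cases i <;>
    simp [Matrix.mulVec, dotProduct, Fin.sum_univ_four, h0, h1, h2, h3, h4, h5, h6, hv, mul_assoc]

theorem IsAffine.exists_third_row_ne_zero {A : Mat4 ℝ} (hA : IsAffine A) (hd : A.det ≠ 0) :
    ∃ i : Fin 3, A 2 i.castSucc ≠ 0 := by
  by_contra! h
  apply hd
  rw [hA.eq_affineMat, det_affineMat]
  exact Matrix.det_eq_zero_of_row_eq_zero 2 h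

/-- If the recurrence of a good basis is upper triangular, there is an isotropic lattice vector. -/
theorem false_of_upper_triangular_return {V : Set ℝ} {δ c : ℝ} (hδ : 0 < δ) (hc : c ≠ 0)
    {y g : Mat4 ℝ} (hy : y ∈ goodBases V δ c) (hg : IsAffine g) {t : ℝ} (ht : 1 ≤ t) {γ : Mat4 ℤ}
    (hγ : γ ∈ affineSL) (hgy : g * y = uni t * y * castMat γ)
    (hg1 : ∀ i j, |g i j - (1 : Mat4 ℝ) i j| < 1 / 10)
    (h20 : g 2 0 = 0) (h21 : g 2 1 = 0) (h10 : g 1 0 = 0) (h11 : g 1 1 = 1)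
    (h02 : g 0 0 * g 2 2 = 1) : False := by
  have g0 := hg 0
  have g1 := hg 1
  have g2 := hg 2
  have g3 := hg 3
  simp at g0 g1 g2 g3
  have hd : y.det ≠ 0 := by rw [hy.2.1]; exact hc
  set U := uni (-t) * g with hU
  have hU0 (j) : U 0 j = g 0 j - t * g 1 j + t ^ 2 / 2 * g 2 j := by
    rw [hU, Matrix.mul_apply, Fin.sum_univ_four]
    simp [uni]
    ring
  have hU1 (j) : U 1 j = g 1 j - t * g 2 j := by
    rw [hU, Matrix.mul_apply, Fin.sum_univ_four]
    simp [uni]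
    ring
  have hU2 (j) : U 2 j = g 2 j := by
    rw [hU, Matrix.mul_apply, Fin.sum_univ_four]
    simp [uni]
  have hU3 (j) : U 3 j = (1 : Mat4 ℝ) 3 j := by
    rw [hU, (uni_mem_isoGroup _).1.mul_apply, hg]
  have hyγ : y * castMat γ = U * y := by
    rw [hU, mul_assoc, hgy, mul_assoc, ← mul_assoc, ← uni_add, neg_add_cancel, uni_zero, one_mul]
  have htrace : U.trace = (γ.trace : ℤ) := by
    have h : U = y * castMat γ * y⁻¹ := by
      rw [hyγ, mul_assoc, Matrix.mul_nonsing_inv _ (isUnit_iff_ne_zero.2 hd), mul_one]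
    rw [h, Matrix.trace_mul_comm, ← mul_assoc,
      Matrix.nonsing_inv_mul _ (isUnit_iff_ne_zero.2 hd), one_mul]
    simp [Matrix.trace, Fin.sum_univ_four]
  have b00 := hg1 0 0
  have b22 := hg1 2 2
  have b01 := hg1 0 1
  have b12 := hg1 1 2
  simp at b00 b22 b01 b12
  rw [abs_lt] at b00 b22 b01 b12
  have htr : U.trace = g 0 0 + g 2 2 + 2 := by
    simp only [Matrix.trace, Fin.sum_univ_four, Matrix.diag, hU0, hU1, hU2, hU3, h20, h21, h10, h11,
      Matrix.one_apply_eq]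
    ring
  have hsum : g 0 0 + g 2 2 = 2 := by
    rw [htr] at htrace
    have u1 : ((γ.trace : ℤ) : ℝ) < (5 : ℤ) := by push_cast; linarith
    have u2 : ((3 : ℤ) : ℝ) < (γ.trace : ℤ) := by push_cast; linarith
    have : γ.trace = 4 := by
      have := Int.cast_lt.1 u1
      have := Int.cast_lt.1 u2
      omega
    rw [this] at htrace
    push_cast at htrace
    linarith
  have e0 : g 0 0 = 1 := by
    have e2 : g 2 2 = 2 - g 0 0 := by linarith
    rw [e2] at h02
    nlinarith [sq_nonneg (g 0 0 - 1)]
  have e2 : g 2 2 = 1 := by linarith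
  obtain ⟨i, hi⟩ := hy.1.exists_third_row_ne_zero hd
  set n : Fin 4 → ℤ := ((γ - 1) * (γ - 1)) *ᵥ Pi.single i.castSucc 1 with hn
  have hyn : y *ᵥ castVec n = ((U - 1) * (U - 1)) *ᵥ (y *ᵥ castVec (Pi.single i.castSucc 1)) := by
    have h : y * castMat ((γ - 1) * (γ - 1)) = (U - 1) * (U - 1) * y := by
      have h1 : y * castMat (γ - 1) = (U - 1) * y := by
        rw [map_sub, map_one, mul_sub, sub_mul, hyγ, mul_one, one_mul]
      rw [map_mul, ← mul_assoc, h1, mul_assoc, h1, mul_assoc]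
    rw [hn, ← castMat_mulVec, Matrix.mulVec_mulVec, h, Matrix.mulVec_mulVec]
  have hn3 (v : Fin 4 → ℤ) : ((γ - 1) *ᵥ v) 3 = 0 := by
    rw [Matrix.sub_mulVec, Pi.sub_apply, hγ.2.mulVec_apply, Matrix.one_mulVec, sub_self]
  have hv2 : (y *ᵥ castVec (Pi.single i.castSucc 1)) = fun j => y j i.castSucc := by
    have : castVec (Pi.single i.castSucc 1) = Pi.single i.castSucc 1 := by
      ext j
      rcases eq_or_ne j i.castSucc with rfl | hj
      · simp [castVec]
      · simp [castVec, hj]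
    rw [this, Matrix.mulVec_single_one]; rfl
  have hp01 : (U - 1) 0 1 ≠ 0 := by
    rw [Matrix.sub_apply, hU0, h11, h21, Matrix.one_apply_ne (by decide)]
    intro h; linarith
  have hp12 : (U - 1) 1 2 ≠ 0 := by
    rw [Matrix.sub_apply, hU1, e2, Matrix.one_apply_ne (by decide)]
    intro h; linarith
  have hy3 : (y *ᵥ castVec (Pi.single i.castSucc 1)) 3 = 0 := by
    rw [hv2]
    refine (hy.1 _).trans ?_
    fin_cases i <;> simp
  rw [mulVec_sq_of_unipotent
    (by rw [Matrix.sub_apply, hU0, e0, h10, h20, Matrix.one_apply_eq]; ring)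
    (by rw [Matrix.sub_apply, hU1, h10, h20, Matrix.one_apply_ne (by decide)]; ring)
    (by rw [Matrix.sub_apply, hU1, h11, h21, Matrix.one_apply_eq]; ring)
    (by rw [Matrix.sub_apply, hU2, h20, Matrix.one_apply_ne (by decide)]; ring)
    (by rw [Matrix.sub_apply, hU2, h21, Matrix.one_apply_ne (by decide)]; ring)
    (by rw [Matrix.sub_apply, hU2, e2, Matrix.one_apply_eq]; ring)
    (fun j => by rw [Matrix.sub_apply, hU3, sub_self]) hy3, hv2] at hyn
  have hne : y *ᵥ castVec n ≠ 0 := fun h0 =>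
    mul_ne_zero (mul_ne_zero hp01 hp12) hi (congrFun (hyn.symm.trans h0) 0)
  have := hy.2.2.2 n (by rw [hn, ← Matrix.mulVec_mulVec]; exact hn3 _) (by
    intro h0
    apply hne
    rw [h0]
    have : castVec 0 = 0 := by ext; simp [castVec]
    rw [this, Matrix.mulVec_zero])
  rw [hyn, quadVal_isoForm] at this
  simp at this
  linarith

theorem isoGram_eq_of_conjCoeff_eq_zero {g : Mat4 ℝ} (hg : IsAffine g) (hd : g.det = 1)
    (h : conjCoeff 0 (isoGram g - isoForm) = 0) :
    ∃ a b : ℝ, isoGram g = isoForm + !![0, 0, 0, 0; 0, 0, 0, 0; 0, 0, a, b; 0, 0, b, 0] := by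
  have hsymm : (isoGram g - isoForm)ᵀ = isoGram g - isoForm := by
    have : isoFormᵀ = isoForm := by
      ext i j; fin_cases i <;> fin_cases j <;> simp [isoForm]
    simp [isoGram, this, mul_assoc]
  have := entries_of_degenerate hsymm h (by rw [add_sub_cancel, det_isoGram])
    (by rw [add_sub_cancel, linDet_isoGram hg hd])
  exact ⟨_, _, (add_sub_cancel _ _).symm.trans (congrArg (isoForm + ·) this)⟩

theorem exists_deformation {V : Set ℝ} {δ c : ℝ} (hδ : 0 < δ) (hc : c ≠ 0)
    {M : Set (Mat4 ℝ)} (hMacc : M ⊆ accBases V δ c) (hM : IsClosed M) (hne : M.Nonempty)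
    (hinv : FlowInvariant M)
    (hmin : ∀ M' ⊆ M, IsClosed M' → M'.Nonempty → FlowInvariant M' → M' = M)
    {ε : ℝ} (hε : 0 < ε) : ∃ y ∈ M, ∃ g : Mat4 ℝ, IsAffine g ∧ g.det = 1 ∧
      g * y ∈ goodBases V δ c ∧ ‖isoGram g - isoForm‖ < ε ∧
        conjCoeff 0 (isoGram g - isoForm) ≠ 0 := by
  by_contra! H
  have hu {z : Mat4 ℝ} (hz : z ∈ M) : IsUnit z.det := by
    rw [(hMacc hz).1.2.1]; exact isUnit_iff_ne_zero.2 hc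
  have key {z A : Mat4 ℝ} (hz : z ∈ M) (hA : A ∈ goodBases V δ c)
      (hn : ‖isoGram (A * z⁻¹) - isoForm‖ < ε) : IsAffine (A * z⁻¹) ∧ ∃ a b : ℝ,
        isoGram (A * z⁻¹) = isoForm + !![0, 0, 0, 0; 0, 0, 0, 0; 0, 0, a, b; 0, 0, b, 0] := by
    have ha := hA.1.mul ((hMacc hz).1.1.inv (hu hz).ne_zero)
    have hd : (A * z⁻¹).det = 1 := by
      rw [Matrix.det_mul, Matrix.det_nonsing_inv, hA.2.1, (hMacc hz).1.2.1, Ring.inverse_eq_inv',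
        mul_inv_cancel₀ hc]
    exact ⟨ha, isoGram_eq_of_conjCoeff_eq_zero ha hd
      (H z hz _ ha hd (by rwa [Matrix.nonsing_inv_mul_cancel_right _ _ (hu hz)]) hn)⟩
  have hone : isoGram 1 = isoForm := by simp [isoGram]
  obtain ⟨y, hy⟩ := hne
  have hcont : Continuous fun A : Mat4 ℝ => A * y⁻¹ := by fun_prop
  have hy1 : y * y⁻¹ = 1 := Matrix.mul_nonsing_inv _ (hu hy)
  have hnear : ∀ᶠ A in 𝓝 y, ‖isoGram (A * y⁻¹) - isoForm‖ < ε ∧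
      ∀ i j, |(A * y⁻¹) i j - (1 : Mat4 ℝ) i j| < 1 / 10 := by
    refine .and ?_ (eventually_all.2 fun i => eventually_all.2 fun j => ?_)
    · refine ((continuous_isoGram.comp hcont).sub continuous_const).norm.continuousAt.eventually_lt
        continuousAt_const ?_
      simpa [hy1, hone] using hε
    · refine (((hcont.matrix_elem i j).sub continuous_const).abs).continuousAt.eventually_lt
        continuousAt_const ?_
      change |(y * y⁻¹) i j - _| < _
      rw [hy1]; simp
  obtain ⟨_, ⟨hg0, hg1⟩, t, ht, γ, hγ, rfl⟩ :=
    mem_closure_iff_nhds.1 (mem_closure_of_minimal hM hinv hmin hy) _ hnear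
  set y' := uni t * y * castMat γ with hy'
  have hy'M : y' ∈ M := hinv y hy t (by linarith) γ hγ
  obtain ⟨hga, a₁, b₁, hg⟩ := key hy (hMacc hy'M).1 hg0
  have hconj (z A : Mat4 ℝ) : isoGram (A * z) = zᵀ * isoGram A * z := isoGram_mul A z
  have hy'1 : y' * y'⁻¹ = 1 := Matrix.mul_nonsing_inv _ (hu hy'M)
  have hcz (z : Mat4 ℝ) : Continuous fun G : Mat4 ℝ => ‖zᵀ * G * z - isoForm‖ := by fun_prop
  have hnear' : ∀ᶠ G in 𝓝 (isoGram y'), ‖(y⁻¹)ᵀ * G * y⁻¹ - isoForm‖ < ε ∧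
      ‖(y'⁻¹)ᵀ * G * y'⁻¹ - isoForm‖ < ε := by
    refine .and ((hcz _).continuousAt.eventually_lt continuousAt_const ?_)
      ((hcz _).continuousAt.eventually_lt continuousAt_const ?_)
    · rwa [← hconj]
    · rw [← hconj, hy'1, hone]; simpa using hε
  obtain ⟨_, ⟨⟨hn1, hn2⟩, A, hA, rfl⟩, hAne⟩ := accPt_iff_nhds.1 (hMacc hy'M).2 _ hnear'
  rw [← hconj] at hn1 hn2
  obtain ⟨-, a₂, b₂, hh⟩ := key hy hA hn1
  obtain ⟨-, a, b, hh'⟩ := key hy'M hA hn2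
  have hmul : A * y⁻¹ = A * y'⁻¹ * (y' * y⁻¹) := by
    rw [← mul_assoc, Matrix.nonsing_inv_mul_cancel_right _ _ (hu hy'M)]
  have hab : a ≠ 0 ∨ b ≠ 0 := by
    by_contra! h0
    apply hAne
    rw [h0.1, h0.2] at hh'
    have hz : isoGram (A * y'⁻¹) = isoForm := by
      rw [hh']; ext i j; fin_cases i <;> fin_cases j <;> simp
    have := hconj y' (A * y'⁻¹)
    rw [Matrix.nonsing_inv_mul_cancel_right _ _ (hu hy'M), hz] at this
    exact this
  have hdiff : (y' * y⁻¹)ᵀ * !![0, 0, 0, 0; 0, 0, 0, 0; 0, 0, a, b; 0, 0, b, 0] * (y' * y⁻¹)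
      = !![0, 0, 0, 0; 0, 0, 0, 0; 0, 0, a₂ - a₁, b₂ - b₁; 0, 0, b₂ - b₁, 0] := by
    have e := hconj (y' * y⁻¹) (A * y'⁻¹)
    rw [← hmul, hh, hh', mul_add, add_mul] at e
    have e' : (y' * y⁻¹)ᵀ * isoForm * (y' * y⁻¹) = _ := hg
    rw [e', add_assoc, add_right_inj] at e
    rw [← sub_eq_iff_eq_add'] at e
    rw [← e]
    ext i j; fin_cases i <;> fin_cases j <;> simp
  have h11 := hg1 1 1
  rw [abs_lt, Matrix.one_apply_eq] at h11
  obtain ⟨h20, h21, h10, h11, h02⟩ :=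
    entries_of_preserves_shape hga hab (by linarith) hg hdiff
  exact false_of_upper_triangular_return hδ hc (hMacc hy).1 hga ht hγ
    (by rw [Matrix.nonsing_inv_mul_cancel_right _ _ (hu hy)]) hg1 h20 h21 h10 h11 h02

/-- Values of inhomogeneous diagonal ternary indefinite forms with irrational ratios are dense. -/
theorem dense_values_ternary {d : Fin 3 → ℝ} (hd0 : 0 < d 0) (hd1 : d 1 < 0) (hd2 : d 2 < 0)
    (h01 : Irrational (d 0 / d 1)) (h02 : Irrational (d 0 / d 2)) (s : Fin 3 → ℝ) :
    Dense {t : ℝ | ∃ n : Fin 3 → ℤ, ∑ i, d i * ((n i : ℝ) + s i) ^ 2 = t} := by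
  by_contra hs
  obtain ⟨δ, hδ, hlow⟩ := exists_pos_le_abs_of_not_dense hd0 hd1 hd2 h01 h02 hs
  obtain ⟨A₀, hA₀, hc, hval, hrow⟩ := exists_basis_ternary hd0 hd1 hd2 s
  set T := {t : ℝ | ∃ n : Fin 3 → ℤ, ∑ i, d i * ((n i : ℝ) + s i) ^ 2 = t} with hT
  have hV : IsClosed (closure T) := isClosed_closure
  have hgood : A₀ ∈ goodBases (closure T) δ A₀.det := by
    refine ⟨hA₀, rfl, fun n hn => ?_, fun n hn hn0 => ?_⟩
    · rw [hval, hn]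
      exact subset_closure ⟨fun i => n i.castSucc, by simp⟩
    · rw [hval, hn]
      have := hlow (fun i => n i.castSucc) fun h => hn0 (funext fun j => by
        refine Fin.lastCases hn (fun i => congrFun h i) j)
      simpa using this
  obtain ⟨C, hC⟩ := exists_affineSL_bounded hc hδ
  have hC' : ∀ A ∈ goodBases (closure T) δ A₀.det,
      ∃ γ ∈ affineSL, ∀ i j, |(A * castMat γ) i j| ≤ C :=
    fun A hA => hC A hA.1 hA.2.1 hA.2.2.2
  obtain ⟨m, hm⟩ := infinite_bounded_values hd0 hd1 h01
  have hacc : (accBases (closure T) δ A₀.det).Nonempty := by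
    refine accBases_nonempty hV hc hgood hC' (I := {n | n 2 = 0 ∧ n 3 = 0 ∧
      quadVal isoForm (A₀ *ᵥ castVec n) ≠ 0 ∧ |quadVal isoForm (A₀ *ᵥ castVec n)| ≤ m}) (m := m)
      (fun n hn => hrow n hn.1 hn.2.1) (fun n hn => ?_) (fun n hn => hn.2.2.1)
      (fun n hn => hn.2.2.2) (hm.mono ?_)
    · rw [hA₀.mulVec_apply, castVec, hn.2.1, Int.cast_zero]
    · rintro _ ⟨p, q, rfl, h0, h1⟩
      have hv : quadVal isoForm (A₀ *ᵥ castVec ![p, q, 0, 0]) = d 0 * p ^ 2 + d 1 * q ^ 2 := by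
        rw [hval, Fin.sum_univ_three]
        simp
      exact ⟨![p, q, 0, 0], ⟨rfl, rfl, by rwa [hv], by rwa [hv]⟩, hv⟩
  have hred : ∀ A ∈ accBases (closure T) δ A₀.det,
      ∃ γ ∈ affineSL, A * castMat γ ∈ {A : Mat4 ℝ | ∀ i j, |A i j| ≤ C} := fun A hA => hC' A hA.1
  obtain ⟨M, hMB, hM, hMne, hinv, hmin⟩ := exists_minimal_flowInvariant
    (isClosed_accBases hV δ A₀.det) hacc (flowInvariant_accBases _ δ _) (isCompact_bounded C) hred
  obtain ⟨ρ, hρ0, hρ, h⟩ := exists_limit_forms hV hM hinv (isCompact_bounded C)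
    (fun A hA => hred A (hMB hA))
    fun ε hε => exists_deformation hδ hc hMB hM hMne hinv hmin hε
  exact hs (dense_iff_closure_eq.2 (Set.eq_univ_of_forall fun r =>
    mem_of_limit_forms hV hM hinv hmin hMne
      (fun A hA => ⟨(hMB hA).1.1, by rw [(hMB hA).1.2.1]; exact hc⟩) hρ0 hρ h r))

end

theorem irrational_sub_div_of_ne {α w : ℝ} (hα : Irrational α) (hw : w ≠ 0) {a b : ℤ} (hab : a ≠ b)
    (ha : ¬ Irrational ((a - α) / w)) : Irrational ((b - α) / w) := by
  rintro ⟨q, hq⟩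
  obtain ⟨p, hp⟩ := exists_rat_of_not_irrational ha
  rw [eq_div_iff hw] at hq
  rw [div_eq_iff hw] at hp
  have hpq : (p : ℝ) - q ≠ 0 := fun h => hab (by
    have : (a : ℝ) = b := by linear_combination hp + hq + w * h
    exact_mod_cast this)
  have hw' : w = (a - b) / (p - q) := by
    rw [eq_div_iff hpq]; linear_combination -hp - hq
  refine hα ⟨a - p * ((a - b) / (p - q)), ?_⟩
  push_cast
  rw [← hw']
  linear_combination hp

theorem exists_int_irrational_div {α u v : ℝ} (hα : Irrational α) (hu : u ≠ 0) (hv : v ≠ 0) :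
    ∃ a : ℤ, 0 < a - α ∧ Irrational ((a - α) / u) ∧ Irrational ((a - α) / v) := by
  by_contra! h
  have hpos (k : ℕ) : 0 < ((⌊α⌋ + 1 + k : ℤ) : ℝ) - α := by
    push_cast
    have := Int.lt_floor_add_one α
    have : (0 : ℝ) ≤ k := k.cast_nonneg
    linarith
  have key (i j k : ℕ) (hij : i ≠ j) (hik : i ≠ k) (hjk : j ≠ k)
      (hi : ¬ Irrational (((⌊α⌋ + 1 + i : ℤ) - α) / u)) : False := by
    have hj := h _ (hpos j) (irrational_sub_div_of_ne hα hu (by omega) hi)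
    have hk := h _ (hpos k) (irrational_sub_div_of_ne hα hu (by omega) hi)
    exact hk (irrational_sub_div_of_ne hα hv (by omega) hj)
  by_cases h0 : Irrational (((⌊α⌋ + 1 + (0 : ℕ) : ℤ) - α) / u)
  · by_cases h1 : Irrational (((⌊α⌋ + 1 + (1 : ℕ) : ℤ) - α) / u)
    · exact h _ (hpos 1) h1 (irrational_sub_div_of_ne hα hv (by omega) (h _ (hpos 0) h0))
    · exact key 1 0 2 (by decide) (by decide) (by decide) h1
  · exact key 0 1 2 (by decide) (by decide) (by decide) h0

theorem sum_cubes_pair (x e : ℤ) (μ ν : ℝ) :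
    ((x : ℝ) - μ) ^ 3 + (((e - x : ℤ) : ℝ) - ν) ^ 3 = (e - (μ + ν)) ^ 3 / 4
      + 3 * (e - (μ + ν)) * (x + (-μ - (e - (μ + ν)) / 2)) ^ 2 := by
  push_cast; ring

theorem dense_sum_cubes_of_irrational_add (μ : Fin 6 → ℝ) (h : Irrational (μ 0 + μ 1)) :
    Dense {t : ℝ | ∃ x : Fin 6 → ℤ, ∑ i, ((x i : ℝ) - μ i) ^ 3 = t} := by
  obtain ⟨b, hb⟩ := exists_int_lt (μ 2 + μ 3)
  obtain ⟨c, hc⟩ := exists_int_lt (μ 4 + μ 5)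
  obtain ⟨a, ha, hab, hac⟩ := exists_int_irrational_div h (sub_neg.2 hb).ne (sub_neg.2 hc).ne
  have hirr {u v : ℝ} (huv : Irrational (u / v)) : Irrational (3 * u / (3 * v)) := by
    rwa [mul_div_mul_left _ _ three_ne_zero]
  have hd := dense_values_ternary
    (d := ![3 * (a - (μ 0 + μ 1)), 3 * (b - (μ 2 + μ 3)), 3 * (c - (μ 4 + μ 5))])
    (mul_pos three_pos ha) (mul_neg_of_pos_of_neg three_pos (sub_neg.2 hb))
    (mul_neg_of_pos_of_neg three_pos (sub_neg.2 hc)) (hirr hab) (hirr hac)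
    ![-μ 0 - (a - (μ 0 + μ 1)) / 2, -μ 2 - (b - (μ 2 + μ 3)) / 2, -μ 4 - (c - (μ 4 + μ 5)) / 2]
  refine ((Homeomorph.addLeft ((a - (μ 0 + μ 1)) ^ 3 / 4 + (b - (μ 2 + μ 3)) ^ 3 / 4
    + (c - (μ 4 + μ 5)) ^ 3 / 4)).surjective.denseRange.dense_image (by fun_prop) hd).mono ?_
  rintro _ ⟨_, ⟨n, rfl⟩, rfl⟩
  refine ⟨![n 0, a - n 0, n 1, b - n 1, n 2, c - n 2], ?_⟩
  have h0 := sum_cubes_pair (n 0) a (μ 0) (μ 1)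
  have h1 := sum_cubes_pair (n 1) b (μ 2) (μ 3)
  have h2 := sum_cubes_pair (n 2) c (μ 4) (μ 5)
  simp only [Fin.sum_univ_six, Fin.sum_univ_three, Homeomorph.coe_addLeft, Matrix.cons_val]
  linear_combination h0 + h1 + h2

theorem exists_perm_irrational_add {ν : Fin 6 → ℝ} (h : Irrational (ν 0)) :
    ∃ σ : Equiv.Perm (Fin 6), Irrational (ν (σ 0) + ν (σ 1)) := by
  by_contra! H
  obtain ⟨p, hp⟩ := exists_rat_of_not_irrational (H 1)
  obtain ⟨q, hq⟩ := exists_rat_of_not_irrational (H (Equiv.swap 1 2))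
  obtain ⟨r, hr⟩ := exists_rat_of_not_irrational (H (finRotate 6))
  have e0 : (Equiv.swap 1 2 : Equiv.Perm (Fin 6)) 0 = 0 := by decide
  have e1 : (Equiv.swap 1 2 : Equiv.Perm (Fin 6)) 1 = 2 := by decide
  have e2 : finRotate 6 0 = 1 := by decide
  have e3 : finRotate 6 1 = 2 := by decide
  rw [e0, e1] at hq
  rw [e2, e3] at hr
  rw [Equiv.Perm.one_apply, Equiv.Perm.one_apply] at hp
  refine h ⟨(p + q - r) / 2, ?_⟩
  push_cast
  linear_combination (-hp - hq + hr) / 2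

theorem dense_sum_cubes_of_injective {ι κ : Type*} [Fintype ι] [Fintype κ] {f : κ → ι}
    (hf : Function.Injective f) (μ : ι → ℝ)
    (h : Dense {t : ℝ | ∃ x : κ → ℤ, ∑ i, ((x i : ℝ) - μ (f i)) ^ 3 = t}) :
    Dense {t : ℝ | ∃ x : ι → ℤ, ∑ i, ((x i : ℝ) - μ i) ^ 3 = t} := by
  classical
  refine ((Homeomorph.addLeft (∑ i ∈ (Finset.univ.map ⟨f, hf⟩)ᶜ, (-μ i) ^ 3)
    ).surjective.denseRange.dense_image (by fun_prop) h).mono ?_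
  rintro _ ⟨_, ⟨x, rfl⟩, rfl⟩
  refine ⟨Function.extend f x 0, ?_⟩
  rw [← Finset.sum_compl_add_sum (Finset.univ.map ⟨f, hf⟩), Finset.sum_map,
    Homeomorph.coe_addLeft]
  congr 1
  · refine Finset.sum_congr rfl fun i hi => ?_
    rw [Function.extend_apply' _ _ _ (by simpa using hi)]
    simp
  · simp [hf.extend_apply]

/-- **Sums of six shifted cubes are dense on the reals.**
If `s ≥ 6` and `μ₁` is irrational, then `F(ℤˢ)` is dense in `ℝ`, where
`F(x) = ∑ᵢ (xᵢ - μᵢ)³`. -/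
theorem sums_of_shifted_cubes_dense
    (s : ℕ) (hs : 6 ≤ s) (μ : Fin s → ℝ)
    (hμ : Irrational (μ ⟨0, by omega⟩)) :
    Dense {t : ℝ | ∃ x : Fin s → ℤ, ∑ i, ((x i : ℝ) - μ i) ^ 3 = t} := by
  obtain ⟨σ, hσ⟩ := exists_perm_irrational_add (ν := fun i => μ (Fin.castLE hs i)) hμ
  exact dense_sum_cubes_of_injective
    (f := fun i => Fin.castLE hs (σ i)) ((Fin.castLE_injective hs).comp σ.injective) μ
    (dense_sum_cubes_of_irrational_add _ hσ)
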